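/- Let k be a field. For each tuple (n, m, d, α) of natural numbers there exists β ∈ ℕ with the following property: for all r ∈ ℕ and all polynomials f₁,…,f_r ∈ k[x₁,…,x_n, y₁,…,y_m] of total degree at most d, if there exist polynomials ȳ₁,…,ȳ_m ∈ k[x₁,…,x_n] with f_i(x, ȳ(x)) ≡ 0 mod (x₁,…,x_n)^β for all i, then there exist power series y₁,…,y_m ∈ k⟦x₁,…,x_n⟧, each algebraic over the polynomial ring k[x₁,…,x_n], such that f_i(x, y(x)) = 0 in k⟦x₁,…,x_n⟧ for all i and ȳ_j ≡ y_j mod (x₁,…,x_n)^α for all j. -/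

import Mathlib

namespace ArtinApprox

section

open MvPowerSeries in
theorem mem_span_X_pow_iff {σ R : Type*} [Finite σ] [CommRing R] (N : ℕ) (f : MvPowerSeries σ R) :
    f ∈ Ideal.span (Set.range (X : σ → MvPowerSeries σ R)) ^ N ↔
      ∀ e : σ →₀ ℕ, e.degree < N → coeff e f = 0 := by
  classical
  have := Fintype.ofFinite σ
  constructor
  · intro hf
    have key : (N : ℕ∞) ≤ f.order := by
      revert hf f
      induction N with
      | zero => intro f _; simp
      | succ N ih =>
        intro f hf
        rw [pow_succ] at hf
        refine Submodule.mul_induction_on hf (fun a ha b hb ↦ ?_) fun a b ha hb ↦ ?_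
        · refine le_trans ?_ le_order_mul
          push_cast
          refine add_le_add (ih _ ha) ?_
          rw [one_le_order_iff_constCoeff_eq_zero]
          have : Ideal.span (Set.range (X : σ → MvPowerSeries σ R)) ≤
              RingHom.ker (constantCoeff (σ := σ) (R := R)) := by
            rw [Ideal.span_le]
            rintro _ ⟨i, rfl⟩
            simp
          exact this hb
        · exact le_trans (le_min ha hb) min_order_le_add
    intro e he
    exact coeff_of_lt_order (lt_of_lt_of_le (by exact_mod_cast he) key)
  · induction N generalizing f with
    | zero => simp
    | succ N ih =>
      intro hf
      have hm : ∀ e : σ →₀ ℕ, ∃ i : Option σ, e ≠ 0 → ∃ j, i = some j ∧ j ∈ e.support := by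
        intro e
        by_cases he : e = 0
        · exact ⟨none, fun h ↦ absurd he h⟩
        · obtain ⟨j, hj⟩ := Finsupp.support_nonempty_iff.mpr he
          exact ⟨some j, fun _ ↦ ⟨j, rfl, hj⟩⟩
      choose m hm using hm
      let g : σ → MvPowerSeries σ R := fun i e ↦
        if m (e + Finsupp.single i 1) = some i then coeff (e + Finsupp.single i 1) f else 0
      have hg : ∀ i e, coeff e (g i) = if m (e + Finsupp.single i 1) = some i then
        coeff (e + Finsupp.single i 1) f else 0 := fun _ _ ↦ rfl
      have hfg : f = ∑ i, g i * X i := by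
        ext e
        rw [map_sum]
        simp only [X, coeff_mul_monomial, hg, mul_one]
        by_cases he : e = 0
        · subst he
          rw [hf 0 (by simp), Finset.sum_eq_zero]
          intro i _
          rw [if_neg]
          simp
        · obtain ⟨j, hj, hje⟩ := hm e he
          have hle : Finsupp.single j 1 ≤ e := by
            rw [Finsupp.single_le_iff]
            exact Nat.one_le_iff_ne_zero.mpr (Finsupp.mem_support_iff.mp hje)
          rw [Finset.sum_eq_single j]
          · rw [if_pos hle, tsub_add_cancel_of_le hle, if_pos hj]
          · intro i _ hi
            split_ifs with h1 h2
            · rw [tsub_add_cancel_of_le h1, hj] at h2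
              exact absurd (Option.some.inj h2).symm hi
            · rfl
            · rfl
          · simp
      rw [hfg, pow_succ]
      refine Ideal.sum_mem _ fun i _ ↦ Ideal.mul_mem_mul (ih _ fun e he ↦ ?_)
        (Ideal.subset_span ⟨i, rfl⟩)
      rw [hg]
      split_ifs
      · apply hf
        rw [map_add, Finsupp.degree_single]
        omega
      · rfl

variable {K : Type*} [Field K] {n : ℕ}

/-- The maximal ideal of `K⟦x₁,…,xₙ⟧`. -/
noncomputable abbrev J (n : ℕ) (K : Type*) [Field K] : Ideal (MvPowerSeries (Fin n) K) :=
  Ideal.span (Set.range MvPowerSeries.X)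

theorem mem_J_pow_iff (N : ℕ) (f : MvPowerSeries (Fin n) K) :
    f ∈ J n K ^ N ↔ ∀ e : Fin n →₀ ℕ, e.degree < N → MvPowerSeries.coeff e f = 0 :=
  mem_span_X_pow_iff N f

theorem mem_J_iff (f : MvPowerSeries (Fin n) K) :
    f ∈ J n K ↔ MvPowerSeries.constantCoeff f = 0 := by
  have := mem_J_pow_iff 1 f
  rw [pow_one] at this
  rw [this]
  constructor
  · intro h
    exact h 0 (by simp)
  · intro h e he
    have : e = 0 := by
      rw [← Finsupp.degree_eq_zero_iff]; omega
    subst this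
    exact h

theorem exists_notMem_J_pow {f : MvPowerSeries (Fin n) K} (hf : f ≠ 0) :
    ∃ N, f ∉ J n K ^ N := by
  obtain ⟨e, he⟩ : ∃ e, MvPowerSeries.coeff e f ≠ 0 := by
    by_contra! h
    exact hf (MvPowerSeries.ext h)
  refine ⟨e.degree + 1, fun h ↦ he ?_⟩
  exact (mem_J_pow_iff _ _).mp h e (Nat.lt_succ_self _)

instance : IsDomain (MvPowerSeries (Fin n) K) := NoZeroDivisors.to_isDomain _

theorem maximalIdeal_eq_J : IsLocalRing.maximalIdeal (MvPowerSeries (Fin n) K) = J n K := by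
  ext f
  rw [mem_J_iff, IsLocalRing.mem_maximalIdeal, mem_nonunits_iff,
    MvPowerSeries.isUnit_iff_constantCoeff, isUnit_iff_ne_zero, not_not]

instance : IsAdicComplete (IsLocalRing.maximalIdeal (MvPowerSeries (Fin n) K))
    (MvPowerSeries (Fin n) K) := by
  rw [maximalIdeal_eq_J]; infer_instance

end

section

variable {K : Type*} [Field K] {n : ℕ}

theorem hasSubst_phiHat (γ : Fin n → ℕ) : MvPowerSeries.HasSubst
    (fun i ↦ MvPowerSeries.X i.succ - MvPowerSeries.X 0 ^ (γ i + 1) :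
      Fin n → MvPowerSeries (Fin (n + 1)) K) :=
  MvPowerSeries.hasSubst_of_constantCoeff_zero fun i ↦ by simp

/-- The substitution `xᵢ ↦ xᵢ₊₁ - x₀ ^ (γᵢ + 1)`. -/
noncomputable def phiHat (γ : Fin n → ℕ) :
    MvPowerSeries (Fin n) K →ₐ[K] MvPowerSeries (Fin (n + 1)) K :=
  MvPowerSeries.substAlgHom (hasSubst_phiHat γ)

theorem phiHat_X (γ : Fin n → ℕ) (i : Fin n) :
    phiHat (K := K) γ (MvPowerSeries.X i) =
      MvPowerSeries.X i.succ - MvPowerSeries.X 0 ^ (γ i + 1) :=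
  MvPowerSeries.substAlgHom_X _ i

/-- The images of the variables under the shear. -/
noncomputable def shearFun (s : K) (γ : Fin n → ℕ) : Fin (n + 1) → MvPowerSeries (Fin (n + 1)) K :=
  Fin.cons (MvPowerSeries.X 0) fun i ↦
    MvPowerSeries.X i.succ + MvPowerSeries.C s * MvPowerSeries.X 0 ^ (γ i + 1)

theorem hasSubst_shearFun (s : K) (γ : Fin n → ℕ) : MvPowerSeries.HasSubst (shearFun s γ) :=
  MvPowerSeries.hasSubst_of_constantCoeff_zero fun i ↦ by
    refine Fin.cases ?_ (fun i ↦ ?_) i <;> simp [shearFun]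

/-- The substitution `x₀ ↦ x₀`, `xᵢ₊₁ ↦ xᵢ₊₁ + s x₀ ^ (γᵢ + 1)`. -/
noncomputable def shear (s : K) (γ : Fin n → ℕ) :
    MvPowerSeries (Fin (n + 1)) K →ₐ[K] MvPowerSeries (Fin (n + 1)) K :=
  MvPowerSeries.substAlgHom (hasSubst_shearFun s γ)

theorem shear_X_zero (s : K) (γ : Fin n → ℕ) :
    shear s γ (MvPowerSeries.X 0) = MvPowerSeries.X 0 :=
  MvPowerSeries.substAlgHom_X _ _

theorem shear_X_succ (s : K) (γ : Fin n → ℕ) (i : Fin n) :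
    shear s γ (MvPowerSeries.X i.succ) =
      MvPowerSeries.X i.succ + MvPowerSeries.C s * MvPowerSeries.X 0 ^ (γ i + 1) :=
  MvPowerSeries.substAlgHom_X _ _

theorem shear_C (s : K) (γ : Fin n → ℕ) (a : K) :
    shear s γ (MvPowerSeries.C a) = MvPowerSeries.C a := 
  (shear s γ).commutes a

theorem shear_shear (s s' : K) (h : s + s' = 0) (γ : Fin n → ℕ)
    (f : MvPowerSeries (Fin (n + 1)) K) :
    shear s γ (shear s' γ f) = f := by
  have : (fun i ↦ shear s γ (shearFun s' γ i)) = MvPowerSeries.X := by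
    funext i
    refine Fin.cases ?_ (fun i ↦ ?_) i
    · simp [shearFun, shear_X_zero]
    · simp only [shearFun, Fin.cons_succ, map_add, map_mul, shear_X_succ, shear_C, map_pow,
        shear_X_zero, add_assoc, ← add_mul]
      simp [← map_add, h]
  simp only [shear] at this ⊢
  rw [MvPowerSeries.substAlgHom_comp_substAlgHom_apply]
  simp only [MvPowerSeries.coe_substAlgHom] at this ⊢
  rw [this, MvPowerSeries.subst_self, id]

/-- The shear as an automorphism. -/
noncomputable def shearEquiv (γ : Fin n → ℕ) :
    MvPowerSeries (Fin (n + 1)) K ≃ₐ[K] MvPowerSeries (Fin (n + 1)) K :=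
  { shear (-1) γ with
    invFun := shear 1 γ
    left_inv := shear_shear 1 (-1) (by simp) γ
    right_inv := shear_shear (-1) 1 (by simp) γ }

/-- The isomorphism `K⟦x'⟧⟦t⟧ ≃ K⟦x⟧`, `t ↦ x₀`, `x'ᵢ ↦ xᵢ₊₁ - x₀ ^ (γᵢ + 1)`. -/
noncomputable def Phi (γ : Fin n → ℕ) :
    PowerSeries (MvPowerSeries (Fin n) K) ≃ₐ[K] MvPowerSeries (Fin (n + 1)) K :=
  (MvPowerSeries.finSuccEquiv K n).symm.trans (shearEquiv γ)

theorem Phi_X (γ : Fin n → ℕ) : Phi (K := K) γ PowerSeries.X = MvPowerSeries.X 0 := by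
  have : (MvPowerSeries.finSuccEquiv K n).symm PowerSeries.X = MvPowerSeries.X 0 := by
    rw [AlgEquiv.symm_apply_eq, MvPowerSeries.finSuccEquiv_X_zero]
  simp only [Phi, AlgEquiv.trans_apply, this]
  exact shear_X_zero _ _

theorem finSuccEquiv_symm_C (a : MvPowerSeries (Fin n) K) :
    (MvPowerSeries.finSuccEquiv K n).symm (PowerSeries.C a) =
      MvPowerSeries.rename (Fin.succEmb n) a := by
  rw [AlgEquiv.symm_apply_eq]
  ext k x
  rw [MvPowerSeries.coeff_coeff_finSuccEquiv, PowerSeries.coeff_C]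
  split_ifs with hk
  · subst hk
    have hx : Finsupp.cons 0 x = Finsupp.embDomain (Fin.succEmb n) x := by
     refine Finsupp.ext fun i ↦ ?_
     refine Fin.cases ?_ (fun i ↦ ?_) i
     · rw [Finsupp.embDomain_of_notMem_range] <;> simp
     · have := Finsupp.embDomain_apply_self (Fin.succEmb n) x i
       simp only [Fin.coe_succEmb] at this
       simp [this]
    rw [hx, MvPowerSeries.coeff_embDomain_rename]
  · rw [MvPowerSeries.coeff_rename_eq_zero]; simp
    rintro ⟨y, hy⟩
    apply hk
    have := DFunLike.congr_fun hy 0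
    rw [Finsupp.mapDomain_of_notMem_range] at this
    · simpa using this.symm
    · simp

theorem Phi_C (γ : Fin n → ℕ) (a : MvPowerSeries (Fin n) K) :
    Phi (K := K) γ (PowerSeries.C a) = phiHat γ a := by
  have : Phi γ (PowerSeries.C a) =
      shear (-1) γ ((MvPowerSeries.finSuccEquiv K n).symm (PowerSeries.C a)) := rfl
  have hs : MvPowerSeries.HasSubst (fun i ↦ MvPowerSeries.X (Fin.succEmb n i) :
      Fin n → MvPowerSeries (Fin (n + 1)) K) :=
    MvPowerSeries.hasSubst_of_constantCoeff_zero fun i ↦ by simp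
  rw [this, finSuccEquiv_symm_C, MvPowerSeries.rename_eq_subst, shear, phiHat,
    MvPowerSeries.coe_substAlgHom, MvPowerSeries.coe_substAlgHom]
  change MvPowerSeries.subst _
    (MvPowerSeries.subst (fun i ↦ MvPowerSeries.X (Fin.succEmb n i)) a) = _
  rw [MvPowerSeries.subst_comp_subst_apply hs (hasSubst_shearFun _ _)]
  congr 1
  funext i
  rw [MvPowerSeries.subst_X (hasSubst_shearFun _ _)]
  simp [shearFun, sub_eq_add_neg]

theorem phiHat_mem_J_pow (γ : Fin n → ℕ) (c : ℕ) {a : MvPowerSeries (Fin n) K}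
    (ha : a ∈ J n K ^ c) : phiHat γ a ∈ J (n + 1) K ^ c := by
  have h : (J n K).map (phiHat γ).toRingHom ≤ J (n + 1) K := by
    rw [Ideal.map_span, Ideal.span_le]
    rintro _ ⟨_, ⟨i, rfl⟩, rfl⟩
    simp only [AlgHom.toRingHom_eq_coe, RingHom.coe_coe, phiHat_X, SetLike.mem_coe]
    rw [mem_J_iff]
    simp
  have := Ideal.mem_map_of_mem (phiHat γ).toRingHom ha
  rw [Ideal.map_pow] at this
  exact Ideal.pow_right_mono h c this

end

section

variable {K : Type*} [Field K] {n : ℕ}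

theorem sum_pow_mul_lt (M : ℕ) (e : ℕ → ℕ) (j : ℕ) (he : ∀ i, e i < M) :
    ∑ i ∈ Finset.range j, M ^ i * e i < M ^ j := by
  induction j with
  | zero => simp
  | succ j ih =>
    rw [Finset.sum_range_succ, pow_succ]
    have h1 : M ^ j * (e j + 1) ≤ M ^ j * M := Nat.mul_le_mul_left _ (he j)
    rw [mul_add, mul_one] at h1
    omega

theorem exists_unique_weight {n : ℕ} (S : Set (Fin n → ℕ)) (hS : S.Nonempty) :
    ∃ M : ℕ, 0 < M ∧ ∃ e ∈ S, ∀ d ∈ S, ∑ i, M ^ i.val * d i = ∑ i, M ^ i.val * e i → d = e := by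
  obtain ⟨e, heS, hmin⟩ := (wellFounded_lt (α := Colex (Fin n → ℕ))).has_min
    (toColex '' S) (hS.image _)
  obtain ⟨e, heS, rfl⟩ := heS
  refine ⟨∑ i, e i + 1, by omega, e, heS, fun d hd hde ↦ ?_⟩
  by_contra hne
  set M := ∑ i, e i + 1 with hM
  have heM : ∀ i, e i < M := fun i ↦
    Nat.lt_succ_of_le (Finset.single_le_sum (f := e) (fun _ _ ↦ Nat.zero_le _) (Finset.mem_univ i))
  have hlt : toColex e < toColex d := by
    rcases lt_trichotomy (toColex e) (toColex d) with h | h | h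
    · exact h
    · exact absurd (toColex_inj.mp h).symm hne
    · exact absurd h (hmin _ ⟨d, hd, rfl⟩)
  obtain ⟨j, hj1, hj2⟩ := hlt
  change ∀ i, j < i → e i = d i at hj1
  change e j < d j at hj2
  let ext (f : Fin n → ℕ) : ℕ → ℕ := fun i ↦ if h : i < n then f ⟨i, h⟩ else 0
  have hext : ∀ (f : Fin n → ℕ) (i : Fin n), ext f i = f i := fun f i ↦ by simp [ext]
  have hsum : ∀ f : Fin n → ℕ, ∑ i, M ^ i.val * f i =
      ∑ i ∈ Finset.range n, M ^ i * ext f i := fun f ↦ by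
    rw [← Fin.sum_univ_eq_sum_range (fun i ↦ M ^ i * ext f i)]
    simp only [hext]
  rw [hsum, hsum] at hde
  have hjn : (j : ℕ) + 1 ≤ n := j.2
  rw [← Finset.sum_range_add_sum_Ico _ hjn, ← Finset.sum_range_add_sum_Ico _ hjn,
    Finset.sum_range_succ, Finset.sum_range_succ] at hde
  have h1 : ∑ i ∈ Finset.Ico ((j : ℕ) + 1) n, M ^ i * ext d i =
      ∑ i ∈ Finset.Ico ((j : ℕ) + 1) n, M ^ i * ext e i := by
    refine Finset.sum_congr rfl fun i hi ↦ ?_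
    rw [Finset.mem_Ico] at hi
    have := hj1 ⟨i, hi.2⟩ (by rw [Fin.lt_def]; exact hi.1)
    simp [ext, hi.2, this]
  have h2 := sum_pow_mul_lt M (ext e) j fun i ↦ by
    by_cases h : i < n
    · simp [ext, h, heM]
    · simp [ext, h, hM]
  have h3 : M ^ (j : ℕ) * (e j + 1) ≤ M ^ (j : ℕ) * d j := Nat.mul_le_mul_left _ hj2
  rw [h1, hext, hext] at hde
  rw [mul_add, mul_one] at h3
  omega

/-- Reduction of a power series in `x` modulo the last variables. -/
theorem exists_phi_regular (h : MvPowerSeries (Fin (n + 1)) K) (hh : h ≠ 0) :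
    ∃ γ : Fin n → ℕ,
      ((Phi γ).symm h).map (IsLocalRing.residue (MvPowerSeries (Fin n) K)) ≠ 0 := by
  classical
  obtain ⟨e₀, he₀⟩ : ∃ e, MvPowerSeries.coeff e h ≠ 0 := by
    by_contra! h'
    exact hh (MvPowerSeries.ext h')
  obtain ⟨M, hM, e, he, huniq⟩ := exists_unique_weight
    {d : Fin (n + 1) → ℕ | MvPowerSeries.coeff (Finsupp.equivFunOnFinite.symm d) h ≠ 0}
    ⟨e₀, by simpa using he₀⟩
  let γ : Fin n → ℕ := fun i ↦ M ^ ((i : ℕ) + 1) - 1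
  have hγ : ∀ i, γ i + 1 = M ^ ((i : ℕ) + 1) := fun i ↦ Nat.sub_add_cancel (Nat.pow_pos hM)
  refine ⟨γ, fun h0 ↦ he ?_⟩
  have hsymm : (Phi γ).symm h = MvPowerSeries.finSuccEquiv K n (shear 1 γ h) := rfl
  let ψ : MvPowerSeries (Fin (n + 1)) K →+* PowerSeries K :=
    (PowerSeries.map (MvPowerSeries.constantCoeff (σ := Fin n) (R := K))).comp
      (MvPowerSeries.finSuccEquiv K n).toRingEquiv.toRingHom
  have hψ : ∀ p, ψ p = PowerSeries.map (MvPowerSeries.constantCoeff (σ := Fin n) (R := K))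
    (MvPowerSeries.finSuccEquiv K n p) := fun _ ↦ rfl
  have hψc : ∀ p k, PowerSeries.coeff k (ψ p) = MvPowerSeries.coeff (Finsupp.cons k 0) p := by
    intro p k
    rw [hψ, PowerSeries.coeff_map, ← MvPowerSeries.coeff_zero_eq_constantCoeff_apply,
      MvPowerSeries.coeff_coeff_finSuccEquiv]
  have hψ0 : ψ (shear 1 γ h) = 0 := by
    ext k
    rw [map_zero]
    have := congrArg (PowerSeries.coeff k) h0
    rw [hsymm, PowerSeries.coeff_map, map_zero, IsLocalRing.residue_eq_zero_iff,
      maximalIdeal_eq_J, mem_J_iff] at this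
    rw [hψ, PowerSeries.coeff_map, this]
  have hψs : ∀ i, ψ (shearFun 1 γ i) = PowerSeries.X ^ (M ^ (i : ℕ)) := by
    intro i
    refine Fin.cases ?_ (fun i ↦ ?_) i
    · simp [shearFun, hψ]
    · simp [shearFun, hψ, hγ]
  have hprod : ∀ d : Fin (n + 1) →₀ ℕ, ψ (d.prod fun s e ↦ shearFun 1 γ s ^ e) =
      PowerSeries.X ^ (∑ i, M ^ i.val * d i) := by
    intro d
    rw [Finsupp.prod_fintype _ _ (by simp), map_prod, ← Finset.prod_pow_eq_pow_sum]
    refine Finset.prod_congr rfl fun i _ ↦ ?_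
    rw [map_pow, hψs, pow_mul]
  have hc := hψc (shear 1 γ h) (∑ i, M ^ i.val * e i)
  rw [hψ0, map_zero, shear, MvPowerSeries.substAlgHom_apply,
    MvPowerSeries.coeff_subst (hasSubst_shearFun _ _),
    finsum_eq_single _ (Finsupp.equivFunOnFinite.symm e), ← hψc, hprod] at hc
  · simpa using hc.symm
  · intro d hd
    rw [← hψc, hprod, PowerSeries.coeff_X_pow]
    by_cases hd0 : MvPowerSeries.coeff d h = 0
    · rw [hd0, zero_smul]
    · rw [if_neg, smul_zero]
      intro heq
      apply hd
      have := huniq d (by simpa using hd0) heq.symm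
      rw [← this]
      simp

end

section

variable {K : Type*} [Field K] {n : ℕ}

theorem weierstrass_shear (h : MvPowerSeries (Fin (n + 1)) K) (hh : h ≠ 0) :
    ∃ (γ : Fin n → ℕ) (W : Polynomial (MvPowerSeries (Fin n) K))
      (u : (PowerSeries (MvPowerSeries (Fin n) K))ˣ), W.Monic ∧ h = Phi γ W * Phi γ u ∧
      (∀ f, ∃ (q : MvPowerSeries (Fin (n + 1)) K) (r : Polynomial (MvPowerSeries (Fin n) K)),
        r.degree < W.natDegree ∧ f = h * q + Phi γ r) ∧
      ∀ (q : PowerSeries (MvPowerSeries (Fin n) K)) (r : Polynomial (MvPowerSeries (Fin n) K)),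
        r.degree < W.natDegree → (W : PowerSeries (MvPowerSeries (Fin n) K)) * q = r → r = 0 := by
  obtain ⟨γ, hγ⟩ := exists_phi_regular h hh
  obtain ⟨W, _, H⟩ := PowerSeries.exists_isWeierstrassFactorization hγ
  obtain ⟨u, rfl⟩ := H.isUnit
  have hdeg : W.natDegree = _ := H.natDegree_eq_toNat_order_map
  refine ⟨γ, W, u, H.isDistinguishedAt.monic, ?_, fun f ↦ ?_, fun q r hr hq ↦ ?_⟩
  · rw [← map_mul, ← H.eq_mul, AlgEquiv.apply_symm_apply]
  · obtain ⟨q, r, hr⟩ := PowerSeries.exists_isWeierstrassDivision (f := (Phi γ).symm f) hγ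
    refine ⟨Phi γ q, r, ?_, ?_⟩
    · rw [hdeg]
      exact hr.degree_lt
    · have := congrArg (Phi γ) hr.eq_mul_add
      simpa using this
  · have : PowerSeries.IsWeierstrassDivision 0 ((Phi γ).symm h) (-(↑u⁻¹ * q)) r := by
      refine ⟨?_, ?_⟩
      · rw [hdeg] at hr
        exact hr
      · rw [H.eq_mul]
        rw [← hq]
        linear_combination (q * W) * u.mul_inv
    exact (this.eq_zero hγ).2

/-- A tower of henselian models for the rings `K⟦x₁,…,xₙ⟧`. -/
structure ApproxSystem (K : Type) [Field K] where
  /-- The model of `K⟦x₁,…,xₙ⟧`. -/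
  A : ℕ → Type
  [commRing : ∀ n, CommRing (A n)]
  [isDomain : ∀ n, IsDomain (A n)]
  [algebra : ∀ n, Algebra K (A n)]
  /-- The comparison with power series. -/
  π : ∀ n, A n →ₐ[K] MvPowerSeries (Fin n) K
  /-- The variables. -/
  X : ∀ n, Fin n → A n
  π_X : ∀ n i, π n (X n i) = MvPowerSeries.X i
  /-- The substitution lifting `phiHat`. -/
  φ : ∀ n, (Fin n → ℕ) → A n →ₐ[K] A (n + 1)
  φ_X : ∀ n γ i, φ n γ (X n i) = X (n + 1) i.succ - X (n + 1) 0 ^ (γ i + 1)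
  π_φ : ∀ n γ a, π (n + 1) (φ n γ a) = phiHat γ (π n a)
  hensel : ∀ n (p : Polynomial (A n)), MvPowerSeries.constantCoeff (π n (p.coeff 0)) = 0 →
    MvPowerSeries.constantCoeff (π n (p.coeff 1)) ≠ 0 → ∃ v, p.eval v = 0

attribute [instance] ApproxSystem.commRing ApproxSystem.isDomain ApproxSystem.algebra

theorem ApproxSystem.isUnit {K : Type} [Field K] (S : ApproxSystem K) {n : ℕ} {a : S.A n}
    (ha : MvPowerSeries.constantCoeff (S.π n a) ≠ 0) : IsUnit a := by
  set a₀ := MvPowerSeries.constantCoeff (S.π n a) with ha₀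
  have hK : ∀ b : K, MvPowerSeries.constantCoeff
      (algebraMap K (MvPowerSeries (Fin n) K) b) = b := MvPowerSeries.constantCoeff_C
  obtain ⟨v, hv⟩ := S.hensel n (Polynomial.C a * Polynomial.X +
    Polynomial.C (a * algebraMap K _ a₀⁻¹ - 1))
    (by simp [hK, ← ha₀, ha]) (by simpa [Polynomial.coeff_one, Polynomial.coeff_C] using ha)
  refine IsUnit.of_mul_eq_one (v + algebraMap K _ a₀⁻¹) ?_
  simp only [Polynomial.eval_add, Polynomial.eval_mul, Polynomial.eval_C, Polynomial.eval_X] at hv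
  linear_combination hv

/-- Systems of equations solvable in power series are approximately solvable in the model. -/
def Approximable {K : Type} [Field K] (S : ApproxSystem K) (n : ℕ) : Prop :=
  ∀ (τ ι : Type) [Finite τ] [Finite ι] (f : ι → MvPolynomial (Fin n ⊕ τ) K)
    (yhat : τ → MvPowerSeries (Fin n) K),
    (∀ i, MvPolynomial.aeval (Sum.elim MvPowerSeries.X yhat) (f i) = 0) → ∀ c : ℕ,
    ∃ y : τ → S.A n, (∀ i, MvPolynomial.aeval (Sum.elim (S.X n) y) (f i) = 0) ∧
      ∀ j, S.π n (y j) - yhat j ∈ J n K ^ c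

theorem aeval_sub_aeval_mem {R : Type*} {σ A : Type*} [CommRing R] [CommRing A] [Algebra R A]
    (I : Ideal A) (a b : σ → A) (h : ∀ i, a i - b i ∈ I) (p : MvPolynomial σ R) :
    MvPolynomial.aeval a p - MvPolynomial.aeval b p ∈ I := by
  rw [← Ideal.Quotient.eq]
  change Ideal.Quotient.mkₐ R I _ = Ideal.Quotient.mkₐ R I _
  rw [← AlgHom.comp_apply, ← AlgHom.comp_apply]
  congr 1
  refine MvPolynomial.algHom_ext fun i ↦ ?_
  simp only [AlgHom.comp_apply, MvPolynomial.aeval_X]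
  exact Ideal.Quotient.eq.mpr (h i)

theorem approximable_zero {K : Type} [Field K] (S : ApproxSystem K) : Approximable S 0 := by
  intro τ ι _ _ f yhat hf c
  have hC : ∀ g : MvPowerSeries (Fin 0) K,
      algebraMap K (MvPowerSeries (Fin 0) K) (MvPowerSeries.constantCoeff g) = g := fun g ↦ by
    ext e
    rw [Subsingleton.elim e 0]
    exact MvPowerSeries.constantCoeff_C (σ := Fin 0) (MvPowerSeries.constantCoeff g)
  refine ⟨fun j ↦ algebraMap K _ (MvPowerSeries.constantCoeff (yhat j)), fun i ↦ ?_, fun j ↦ ?_⟩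
  · have h1 : (Sum.elim (S.X 0) fun j ↦ algebraMap K _ (MvPowerSeries.constantCoeff (yhat j))) =
        fun s ↦ Algebra.ofId K (S.A 0) (Sum.elim (fun i ↦ i.elim0)
          (fun j ↦ MvPowerSeries.constantCoeff (yhat j)) s) := by
      funext s
      rcases s with s | s
      · exact s.elim0
      · rfl
    have h2 : (Sum.elim MvPowerSeries.X yhat) =
        fun s ↦ Algebra.ofId K (MvPowerSeries (Fin 0) K) (Sum.elim (fun i ↦ i.elim0)
          (fun j ↦ MvPowerSeries.constantCoeff (yhat j)) s) := by
      funext s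
      rcases s with s | s
      · exact s.elim0
      · exact (hC _).symm
    have h3 := hf i
    rw [h2, ← MvPolynomial.comp_aeval_apply] at h3
    rw [h1, ← MvPolynomial.comp_aeval_apply]
    rw [(map_eq_zero_iff _ (algebraMap K (MvPowerSeries (Fin 0) K)).injective).mp h3, map_zero]
  · rw [AlgHom.commutes, hC, sub_self]
    exact Ideal.zero_mem _

end

section

section Generic

variable (n E : ℕ) (τ K : Type) [Field K]

/-- Polynomials in `x'`, the coefficients of a generic monic polynomial of degree `E` and those of
generic polynomials of degree less than `E`. -/
abbrev GenCoeff : Type := MvPolynomial (Fin n ⊕ (Fin E ⊕ τ × Fin E)) K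

/-- The generic monic polynomial of degree `E`. -/
noncomputable def genW : Polynomial (GenCoeff n E τ K) :=
  Polynomial.X ^ E + ∑ l : Fin E,
    Polynomial.C (MvPolynomial.X (Sum.inr (Sum.inl l))) * Polynomial.X ^ (l : ℕ)

variable {τ}

/-- The generic polynomial of degree less than `E`. -/
noncomputable def genY (j : τ) : Polynomial (GenCoeff n E τ K) :=
  ∑ l : Fin E, Polynomial.C (MvPolynomial.X (Sum.inr (Sum.inr (j, l)))) * Polynomial.X ^ (l : ℕ)

variable {n K}

/-- Substitution of the generic polynomials. -/
noncomputable def genSubst (γ : Fin n → ℕ) :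
    MvPolynomial (Fin (n + 1) ⊕ τ) K →ₐ[K] Polynomial (GenCoeff n E τ K) :=
  MvPolynomial.aeval (Sum.elim
    (Fin.cons Polynomial.X fun i ↦
      Polynomial.C (MvPolynomial.X (Sum.inl i)) + Polynomial.X ^ (γ i + 1))
    (genY n E K))

variable {E}

theorem genW_monic : (genW n E τ K).Monic :=
  Polynomial.monic_X_pow_add (Polynomial.degree_sum_fin_lt _)

theorem natDegree_genW : (genW n E τ K).natDegree = E := by
  have h := Polynomial.degree_sum_fin_lt
    (fun l : Fin E ↦ (MvPolynomial.X (Sum.inr (Sum.inl l)) : GenCoeff n E τ K))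
  refine Polynomial.natDegree_eq_of_degree_eq_some ?_
  rw [genW, Polynomial.degree_add_eq_left_of_degree_lt, Polynomial.degree_X_pow]
  rwa [Polynomial.degree_X_pow]

theorem eval_genSubst (γ : Fin n → ℕ) {R : Type*} [CommRing R] [Algebra K R]
    (θ : Polynomial (GenCoeff n E τ K) →ₐ[K] R) (x : Fin (n + 1) → R)
    (h0 : θ Polynomial.X = x 0)
    (hx : ∀ i, θ (Polynomial.C (MvPolynomial.X (Sum.inl i))) = x i.succ - x 0 ^ (γ i + 1))
    (p : MvPolynomial (Fin (n + 1) ⊕ τ) K) :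
    θ (genSubst E γ p) = MvPolynomial.aeval (Sum.elim x fun j ↦ θ (genY n E K j)) p := by
  rw [genSubst, MvPolynomial.comp_aeval_apply]
  congr 2
  funext s
  rcases s with s | j
  · refine Fin.cases ?_ (fun i ↦ ?_) s
    · simpa using h0
    · simp [hx, h0]
  · rfl

end Generic

variable {K : Type} [Field K] {n E : ℕ} {τ : Type}

/-- Evaluation of the generic polynomials in the model. -/
noncomputable def evModel (S : ApproxSystem K) (γ : Fin n → ℕ)
    (v : Fin E ⊕ τ × Fin E → S.A n) : Polynomial (GenCoeff n E τ K) →ₐ[K] S.A (n + 1) :=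
  Polynomial.eval₂AlgHom ((S.φ n γ).comp (MvPolynomial.aeval (Sum.elim (S.X n) v)))
    (S.X (n + 1) 0) fun _ ↦ Commute.all _ _

/-- Evaluation of the generic polynomials in power series. -/
noncomputable def evHat (γ : Fin n → ℕ)
    (v : Fin E ⊕ τ × Fin E → MvPowerSeries (Fin n) K) :
    Polynomial (GenCoeff n E τ K) →ₐ[K] MvPowerSeries (Fin (n + 1)) K :=
  Polynomial.eval₂AlgHom ((phiHat γ).comp (MvPolynomial.aeval (Sum.elim MvPowerSeries.X v)))
    (MvPowerSeries.X 0) fun _ ↦ Commute.all _ _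

theorem evHat_eq (γ : Fin n → ℕ) (v : Fin E ⊕ τ × Fin E → MvPowerSeries (Fin n) K)
    (P : Polynomial (GenCoeff n E τ K)) :
    evHat γ v P = Phi γ ((P.map (MvPolynomial.aeval (R := K)
      (Sum.elim MvPowerSeries.X v)).toRingHom : Polynomial _) : PowerSeries _) := by
  have : (evHat γ v).toRingHom = ((Phi γ).toRingEquiv.toRingHom.comp
      Polynomial.coeToPowerSeries.ringHom).comp (Polynomial.mapRingHom
        (MvPolynomial.aeval (R := K) (Sum.elim MvPowerSeries.X v)).toRingHom) := by
    refine Polynomial.ringHom_ext (fun a ↦ ?_) ?_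
    · simp only [evHat, AlgHom.toRingHom_eq_coe, RingHom.coe_coe, Polynomial.eval₂AlgHom_apply,
        Polynomial.eval₂_C, RingHom.comp_apply, Polynomial.coe_mapRingHom, Polynomial.map_C,
        Polynomial.coeToPowerSeries.ringHom_apply, Polynomial.coe_C]
      exact (Phi_C ..).symm
    · simp [evHat, Phi_X]
  exact DFunLike.congr_fun this P

theorem evModel_sub_evHat_mem (S : ApproxSystem K) (γ : Fin n → ℕ) (c : ℕ)
    (v : Fin E ⊕ τ × Fin E → S.A n) (vhat : Fin E ⊕ τ × Fin E → MvPowerSeries (Fin n) K)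
    (hv : ∀ j, S.π n (v j) - vhat j ∈ J n K ^ c) (P : Polynomial (GenCoeff n E τ K)) :
    S.π (n + 1) (evModel S γ v P) - evHat γ vhat P ∈ J (n + 1) K ^ c := by
  have : (Ideal.Quotient.mk (J (n + 1) K ^ c)).comp
      ((S.π (n + 1)).comp (evModel S γ v)).toRingHom =
      (Ideal.Quotient.mk (J (n + 1) K ^ c)).comp (evHat γ vhat).toRingHom := by
    refine Polynomial.ringHom_ext (fun a ↦ ?_) ?_
    · refine Ideal.Quotient.eq.mpr ?_
      simp only [AlgHom.toRingHom_eq_coe, RingHom.coe_coe, AlgHom.comp_apply, evModel, evHat,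
        Polynomial.eval₂AlgHom_apply, Polynomial.eval₂_C]
      simp only [S.π_φ]
      rw [← map_sub]
      refine phiHat_mem_J_pow γ c ?_
      rw [MvPolynomial.comp_aeval_apply]
      refine aeval_sub_aeval_mem _ _ _ (fun i ↦ ?_) a
      rcases i with i | j
      · simp [S.π_X]
      · exact hv j
    · simp [evModel, evHat, S.π_X]
  exact Ideal.Quotient.eq.mp (DFunLike.congr_fun this P)

set_option maxHeartbeats 400000 in
/-- Weierstrass preparation step: solve the equations modulo `D ^ 2 * x₀ ^ c`. -/
theorem Approximable.exists_approx {S : ApproxSystem K} (hS : Approximable S n)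
    {τ ι : Type} [Finite τ] [Finite ι] (F : ι → MvPolynomial (Fin (n + 1) ⊕ τ) K)
    (D : MvPolynomial (Fin (n + 1) ⊕ τ) K) (yhat : τ → MvPowerSeries (Fin (n + 1)) K)
    (hF : ∀ i, MvPolynomial.aeval (Sum.elim MvPowerSeries.X yhat) (F i) = 0)
    (hD : MvPolynomial.aeval (Sum.elim MvPowerSeries.X yhat) D ≠ 0) (c : ℕ) (hc : c ≠ 0) :
    ∃ y : τ → S.A (n + 1), (∀ j, S.π (n + 1) (y j) - yhat j ∈ J (n + 1) K ^ c) ∧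
      ∀ i, ∃ q, MvPolynomial.aeval (Sum.elim (S.X (n + 1)) y) (F i) =
        MvPolynomial.aeval (Sum.elim (S.X (n + 1)) y) D ^ 2 * S.X (n + 1) 0 ^ c * q := by
  set Dh := MvPolynomial.aeval (Sum.elim MvPowerSeries.X yhat) D with hDh
  set h := Dh ^ 2 * MvPowerSeries.X 0 ^ c with hh
  have hX0 : (MvPowerSeries.X 0 : MvPowerSeries (Fin (n + 1)) K) ≠ 0 := by
    intro h0
    have := congrArg (MvPowerSeries.coeff (Finsupp.single 0 1)) h0
    simp [MvPowerSeries.coeff_X] at this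
  have hX0J : (MvPowerSeries.X 0 : MvPowerSeries (Fin (n + 1)) K) ∈ J (n + 1) K :=
    Ideal.subset_span ⟨0, rfl⟩
  have hh0 : h ≠ 0 := mul_ne_zero (pow_ne_zero _ hD) (pow_ne_zero _ hX0)
  obtain ⟨γ, W, u, hW, hWu, hdiv, huniq⟩ := weierstrass_shear h hh0
  choose q r hr hqr using fun j ↦ hdiv (yhat j)
  set E := W.natDegree with hE
  let vhat : Fin E ⊕ τ × Fin E → MvPowerSeries (Fin n) K :=
    Sum.elim (fun l ↦ W.coeff l) (fun jl ↦ (r jl.1).coeff jl.2)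
  let evh : GenCoeff n E τ K →ₐ[K] MvPowerSeries (Fin n) K :=
    MvPolynomial.aeval (Sum.elim MvPowerSeries.X vhat)
  have hmapW : (genW n E τ K).map evh.toRingHom = W := by
    refine Eq.trans ?_ hW.as_sum.symm
    rw [← hE, genW, Polynomial.map_add, Polynomial.map_pow, Polynomial.map_X,
      Polynomial.map_sum, ← Fin.sum_univ_eq_sum_range (fun l ↦ Polynomial.C (W.coeff l) *
        Polynomial.X ^ l)]
    congr 1
    refine Finset.sum_congr rfl fun l _ ↦ ?_
    rw [Polynomial.map_mul, Polynomial.map_pow, Polynomial.map_X, Polynomial.map_C]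
    congr 2
    exact MvPolynomial.aeval_X _ _
  have hmapY : ∀ j, (genY n E K j).map evh.toRingHom = r j := by
    intro j
    have h1 : r j = ∑ l ∈ Finset.range E, Polynomial.C ((r j).coeff l) * Polynomial.X ^ l := by
      by_cases h0 : r j = 0
      · simp [h0]
      · exact (r j).as_sum_range_C_mul_X_pow' ((Polynomial.natDegree_lt_iff_degree_lt h0).mpr
          (hr j))
    refine Eq.trans ?_ h1.symm
    · rw [genY, Polynomial.map_sum, ← Fin.sum_univ_eq_sum_range
        (fun l ↦ Polynomial.C ((r j).coeff l) * Polynomial.X ^ l)]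
      refine Finset.sum_congr rfl fun l _ ↦ ?_
      rw [Polynomial.map_mul, Polynomial.map_pow, Polynomial.map_X, Polynomial.map_C]
      congr 2
      exact MvPolynomial.aeval_X _ _
  have hHW : evHat γ vhat (genW n E τ K) = Phi γ W := by rw [evHat_eq, ← hmapW]
  rw [← hHW] at hWu
  have hPW : evHat γ vhat (genW n E τ K) ≠ 0 := by
    intro h0
    rw [h0, zero_mul] at hWu
    exact hh0 hWu
  have hHY : ∀ j, evHat γ vhat (genY n E K j) = Phi γ (r j) := fun j ↦ by
    rw [evHat_eq, ← hmapY]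
  have hHsub : ∀ p, evHat γ vhat (genSubst E γ p) =
      MvPolynomial.aeval (Sum.elim MvPowerSeries.X fun j ↦ Phi γ (r j)) p := by
    intro p
    rw [eval_genSubst γ _ MvPowerSeries.X]
    · simp only [hHY]
    · simp [evHat]
    · intro i
      simp [evHat, phiHat_X]
  have hcong : ∀ p, h ∣ evHat γ vhat (genSubst E γ p) -
      MvPolynomial.aeval (Sum.elim MvPowerSeries.X yhat) p := by
    intro p
    rw [hHsub, ← Ideal.mem_span_singleton]
    refine aeval_sub_aeval_mem _ _ _ (fun i ↦ ?_) p
    rcases i with i | j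
    · simp
    · rw [Ideal.mem_span_singleton]
      refine ⟨-q j, ?_⟩
      simp only [Sum.elim_inr]
      rw [hqr j]
      ring
  have hmodH : ∀ p, h ∣ MvPolynomial.aeval (Sum.elim MvPowerSeries.X yhat) p →
      (genSubst E γ p %ₘ genW n E τ K).map evh.toRingHom = 0 := by
    intro p hp
    have h1 : h ∣ evHat γ vhat (genSubst E γ p) := (dvd_iff_dvd_of_dvd_sub (hcong p)).mpr hp
    rw [hWu, hHW, ← map_mul, evHat_eq, map_dvd_iff] at h1
    obtain ⟨s, hs⟩ := h1
    set P := (genSubst E γ p).map evh.toRingHom with hP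
    have h2 : P %ₘ W = 0 := by
      refine huniq (u * s - (P /ₘ W : Polynomial _)) _ ?_ ?_
      · rw [← Polynomial.degree_eq_natDegree hW.ne_zero]
        exact Polynomial.degree_modByMonic_lt _ hW
      · have h3 := congrArg (fun p : Polynomial _ ↦ (p : PowerSeries (MvPowerSeries (Fin n) K)))
          (Polynomial.modByMonic_add_div P W)
        simp only [Polynomial.coe_add, Polynomial.coe_mul] at h3
        change (P : PowerSeries (MvPowerSeries (Fin n) K)) = _ at hs
        linear_combination -h3 - hs
    have h4 := Polynomial.map_modByMonic evh.toRingHom (p := genSubst E γ p)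
      (genW_monic (K := K) (n := n) (E := E) (τ := τ))
    rw [hmapW, ← hP, h2] at h4
    exact h4
  have hvanish : ∀ p, h ∣ MvPolynomial.aeval (Sum.elim MvPowerSeries.X yhat) p →
      ∀ l, MvPolynomial.aeval (Sum.elim MvPowerSeries.X vhat)
        ((genSubst E γ p %ₘ genW n E τ K).coeff l) = 0 := by
    intro p hp l
    have := congrArg (fun p ↦ Polynomial.coeff p l) (hmodH p hp)
    rwa [Polynomial.coeff_map, Polynomial.coeff_zero] at this
  let p : Option ι → MvPolynomial (Fin (n + 1) ⊕ τ) K :=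
    fun o ↦ o.elim (D ^ 2 * MvPolynomial.X (Sum.inl 0) ^ c) F
  obtain ⟨v, hv, hvJ⟩ := hS (Fin E ⊕ τ × Fin E) (Option ι × Fin E)
    (fun s ↦ (genSubst E γ (p s.1) %ₘ genW n E τ K).coeff s.2) vhat (fun s ↦ by
      refine hvanish _ ?_ _
      rcases s with ⟨_ | i, l⟩
      · simp [p, hh, ← hDh]
      · simp [p, hF]) c
  have hmod : ∀ o, evModel S γ v (genSubst E γ (p o)) =
      evModel S γ v (genW n E τ K) * evModel S γ v (genSubst E γ (p o) /ₘ genW n E τ K) := by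
    intro o
    have h1 : evModel S γ v (genSubst E γ (p o) %ₘ genW n E τ K) = 0 := by
      rw [evModel, Polynomial.eval₂AlgHom_apply, Polynomial.eval₂_eq_sum,
        Polynomial.sum_def]
      refine Finset.sum_eq_zero fun l hl ↦ ?_
      have hlE : l < E := by
        by_contra hlt
        refine Polynomial.mem_support_iff.mp hl (Polynomial.coeff_eq_zero_of_degree_lt ?_)
        refine (Polynomial.degree_modByMonic_lt _ genW_monic).trans_le ?_
        rw [Polynomial.degree_eq_natDegree genW_monic.ne_zero, natDegree_genW]
        exact_mod_cast not_lt.mp hlt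
      have := hv (o, ⟨l, hlE⟩)
      rw [RingHom.coe_coe, AlgHom.comp_apply, this, map_zero, zero_mul]
    conv_lhs => rw [← Polynomial.modByMonic_add_div (genSubst E γ (p o)) (genW n E τ K)]
    rw [map_add, h1, zero_add, map_mul]
  have hsub : ∀ p, evModel S γ v (genSubst E γ p) = MvPolynomial.aeval (Sum.elim (S.X (n + 1))
      fun j ↦ evModel S γ v (genY n E K j)) p := by
    intro p
    refine eval_genSubst γ _ (S.X (n + 1)) ?_ ?_ p
    · simp [evModel]
    · intro i
      simp [evModel, S.φ_X]
  have hcomp := evModel_sub_evHat_mem S γ c v vhat hvJ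
  refine ⟨fun j ↦ evModel S γ v (genY n E K j), fun j ↦ ?_, fun i ↦ ?_⟩
  · have h1 := hcomp (genY n E K j)
    rw [hHY] at h1
    have h2 : S.π (n + 1) (evModel S γ v (genY n E K j)) - yhat j =
        (S.π (n + 1) (evModel S γ v (genY n E K j)) - Phi γ (r j)) -
          MvPowerSeries.X 0 ^ c * (Dh ^ 2 * q j) := by
      rw [hqr j, hh]; ring
    rw [h2]
    exact Ideal.sub_mem _ h1 (Ideal.mul_mem_right _ _ (Ideal.pow_mem_pow hX0J c))
  · set Q := fun o ↦ evModel S γ v (genSubst E γ (p o) /ₘ genW n E τ K) with hQ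
    have hF' : MvPolynomial.aeval (Sum.elim (S.X (n + 1)) fun j ↦
        evModel S γ v (genY n E K j)) (F i) = evModel S γ v (genW n E τ K) * Q (some i) := by
      rw [← hsub]
      exact hmod (some i)
    have hD' : MvPolynomial.aeval (Sum.elim (S.X (n + 1)) fun j ↦
        evModel S γ v (genY n E K j)) D ^ 2 * S.X (n + 1) 0 ^ c =
        evModel S γ v (genW n E τ K) * Q none := by
      have := hmod none
      rw [hsub] at this
      rw [← this]
      simp [p]
    have hunit : IsUnit (Q none) := by
      refine S.isUnit ?_
      have h1 := hcomp (genSubst E γ (p none) /ₘ genW n E τ K)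
      have h2 : h ∣ MvPolynomial.aeval (Sum.elim MvPowerSeries.X yhat) (p none) := by
        simp [p, hh, ← hDh]
      obtain ⟨k, hk⟩ := hcong D
      rw [← hDh, sub_eq_iff_eq_add] at hk
      set e := 1 + Dh * MvPowerSeries.X 0 ^ c * k with he
      have h3 : evHat γ vhat (genSubst E γ (p none)) = h * e ^ 2 := by
        simp only [p, Option.elim_none, map_mul, map_pow, hk]
        rw [hHsub, MvPolynomial.aeval_X, Sum.elim_inl, he, hh]
        ring
      have h4 : evHat γ vhat (genSubst E γ (p none)) =
          evHat γ vhat (genW n E τ K) *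
          evHat γ vhat (genSubst E γ (p none) /ₘ genW n E τ K) := by
        conv_lhs => rw [← Polynomial.modByMonic_add_div (genSubst E γ (p none)) (genW n E τ K)]
        rw [map_add, map_mul, evHat_eq γ vhat (_ %ₘ _), hmodH _ h2, Polynomial.coe_zero,
          map_zero, zero_add]
      have h5 : evHat γ vhat (genSubst E γ (p none) /ₘ genW n E τ K) = Phi γ u * e ^ 2 := by
        refine mul_left_cancel₀ hPW ?_
        rw [← h4, h3, hWu, mul_assoc]
      have h6 : MvPowerSeries.constantCoeff e = 1 := by
        simp [he, hc]
      have h7 := (mem_J_iff _).mp (Ideal.pow_le_self hc h1)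
      rw [map_sub, sub_eq_zero] at h7
      have h8 : MvPowerSeries.constantCoeff (evHat γ vhat
          (genSubst E γ (p none) /ₘ genW n E τ K)) ≠ 0 := by
        rw [h5, map_mul, map_pow, h6, one_pow, mul_one]
        exact ((u.isUnit.map (Phi γ)).map MvPowerSeries.constantCoeff).ne_zero
      rw [← h7] at h8
      exact h8
    obtain ⟨w, hw⟩ := hunit.exists_right_inv
    refine ⟨w * Q (some i), ?_⟩
    rw [hF', hD']
    linear_combination (-evModel S γ v (genW n E τ K) * Q (some i)) * hw

end

section Cartier

variable {N : ℕ} {K : Type} [Field K]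

/-- A Cartier-type operator on power series. -/
noncomputable def cartier (p : ℕ) (ν : Fin N →₀ ℕ) (ℓ : K →+ K) :
    MvPowerSeries (Fin N) K →+ MvPowerSeries (Fin N) K where
  toFun f := fun e ↦ ℓ (MvPowerSeries.coeff (p • e + ν) f)
  map_zero' := by
    funext e
    simp
    rfl
  map_add' f g := by
    funext e
    simp
    rfl

theorem coeff_cartier (p : ℕ) (ν : Fin N →₀ ℕ) (ℓ : K →+ K) (f : MvPowerSeries (Fin N) K)
    (e : Fin N →₀ ℕ) : MvPowerSeries.coeff e (cartier p ν ℓ f) =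
      ℓ (MvPowerSeries.coeff (p • e + ν) f) := rfl

theorem cartier_pow_mul (p : ℕ) [hp : Fact p.Prime] [CharP K p] (ν : Fin N →₀ ℕ)
    (hν : ∀ i, ν i < p) (ℓ : K →+ K) (hℓ : ∀ a b, ℓ (a ^ p * b) = a * ℓ b)
    (g f : MvPowerSeries (Fin N) K) : cartier p ν ℓ (g ^ p * f) = g * cartier p ν ℓ f := by
  classical
  have hp0 := hp.out.ne_zero
  have hg1 : ∀ m, MvPowerSeries.coeff (p • m) (g ^ p) = MvPowerSeries.coeff m g ^ p := fun m ↦ by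
    rw [← MvPowerSeries.map_frobenius_expand p hp0, MvPowerSeries.coeff_map,
      MvPowerSeries.coeff_expand_smul, frobenius_def]
  have hg2 : ∀ m i, ¬ p ∣ m i → MvPowerSeries.coeff m (g ^ p) = 0 := fun m i h ↦ by
    rw [← MvPowerSeries.map_frobenius_expand p hp0, MvPowerSeries.coeff_map,
      MvPowerSeries.coeff_expand_of_not_dvd p hp0 g h, map_zero]
  ext e
  rw [coeff_cartier, MvPowerSeries.coeff_mul, MvPowerSeries.coeff_mul, map_sum]
  symm
  refine Finset.sum_of_injOn (fun uv ↦ (p • uv.1, p • uv.2 + ν)) ?_ ?_ ?_ ?_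
  · rintro ⟨a, b⟩ - ⟨c, d⟩ - h
    simp only [Prod.mk.injEq, add_left_inj] at h
    exact Prod.ext (nsmul_right_injective hp0 h.1) (nsmul_right_injective hp0 h.2)
  · rintro ⟨a, b⟩ h
    rw [Finset.mem_coe, Finset.HasAntidiagonal.mem_antidiagonal] at h ⊢
    simp only at h ⊢
    rw [← h, smul_add, add_assoc]
  · rintro ⟨a, b⟩ h h'
    rw [Finset.HasAntidiagonal.mem_antidiagonal] at h
    simp only at h ⊢
    by_cases hd : ∀ i, p ∣ a i
    · exfalso
      choose a' ha' using hd
      have hle : ∀ i, a' i ≤ e i := fun i ↦ by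
        have h1 := DFunLike.congr_fun h i
        simp only [Finsupp.add_apply, Finsupp.smul_apply, smul_eq_mul, ha'] at h1
        by_contra hlt
        have h2 : p * (e i + 1) ≤ p * a' i := Nat.mul_le_mul_left p (by omega)
        have h3 := hν i
        rw [mul_add] at h2
        omega
      refine h' ⟨(Finsupp.equivFunOnFinite.symm a', Finsupp.equivFunOnFinite.symm
        fun i ↦ e i - a' i), ?_, Prod.ext ?_ ?_⟩
      · rw [Finset.mem_coe, Finset.HasAntidiagonal.mem_antidiagonal]
        ext i
        simp [hle]
      · ext i
        simp [ha']
      · ext i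
        have h1 := DFunLike.congr_fun h i
        have h2 := Nat.mul_le_mul_left p (hle i)
        simp only [Finsupp.add_apply, Finsupp.smul_apply, smul_eq_mul, ha'] at h1
        simp [Nat.mul_sub]
        omega
    · push Not at hd
      obtain ⟨i, hi⟩ := hd
      rw [hg2 a i hi, zero_mul, map_zero]
  · rintro ⟨a, b⟩ -
    simp only
    rw [hg1, hℓ, coeff_cartier]

theorem exists_coe_eq_of_coeff_eq_zero (f : MvPowerSeries (Fin N) K) (n : ℕ)
    (hf : ∀ e, n ≤ e.degree → MvPowerSeries.coeff e f = 0) :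
    ∃ p : MvPolynomial (Fin N) K, (p : MvPowerSeries (Fin N) K) = f := by
  refine ⟨MvPowerSeries.truncTotal n f, ?_⟩
  ext e
  rw [MvPolynomial.coeff_coe]
  rcases lt_or_ge e.degree n with h | h
  · rw [MvPowerSeries.coeff_truncTotal _ h]
  · rw [MvPowerSeries.coeff_truncTotal_eq_zero _ h, hf e h]

theorem exists_cartier_coe (p : ℕ) [hp : Fact p.Prime] (ν : Fin N →₀ ℕ) (ℓ : K →+ K)
    (a : MvPolynomial (Fin N) K) : ∃ b : MvPolynomial (Fin N) K,
      (b : MvPowerSeries (Fin N) K) = cartier p ν ℓ a := by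
  refine exists_coe_eq_of_coeff_eq_zero _ (a.totalDegree + 1) fun e he ↦ ?_
  rw [coeff_cartier, MvPolynomial.coeff_coe, MvPolynomial.coeff_eq_zero_of_totalDegree_lt, map_zero]
  refine lt_of_lt_of_le he ?_
  rw [← Finsupp.degree_apply, map_add, map_nsmul, smul_eq_mul]
  nlinarith [hp.out.one_lt]

/-- The field `K`, on which `K` acts through the Frobenius. -/
def FrobeniusModule (_ : ℕ) (K : Type) : Type := K

noncomputable instance (p : ℕ) : AddCommGroup (FrobeniusModule p K) :=
  inferInstanceAs (AddCommGroup K)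

noncomputable instance (p : ℕ) [Fact p.Prime] [CharP K p] : Module K (FrobeniusModule p K) :=
  Module.compHom K (frobenius K p)

theorem exists_cartier_ne_zero (p : ℕ) [hp : Fact p.Prime] [CharP K p]
    (f : MvPowerSeries (Fin N) K) (hf : f ≠ 0) :
    ∃ (ν : Fin N →₀ ℕ) (ℓ : K →+ K), (∀ i, ν i < p) ∧ (∀ a b, ℓ (a ^ p * b) = a * ℓ b) ∧
      cartier p ν ℓ f ≠ 0 := by
  obtain ⟨d, hd⟩ := (MvPowerSeries.ne_zero_iff_exists_coeff_ne_zero f).mp hf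
  obtain ⟨ℓ, hℓ⟩ : ∃ ℓ : K →+ K, (∀ a b, ℓ (a ^ p * b) = a * ℓ b) ∧
      ℓ (MvPowerSeries.coeff d f) ≠ 0 := by
    by_contra! hc
    refine hd ((Module.forall_dual_apply_eq_zero_iff (V := FrobeniusModule p K) K _).mp fun φ ↦ ?_)
    exact hc φ.toAddMonoidHom fun a b ↦ φ.map_smul a b
  refine ⟨d.mapRange (· % p) (Nat.zero_mod p), ℓ, fun i ↦ Nat.mod_lt _ hp.out.pos, hℓ.1,
    fun h0 ↦ hℓ.2 ?_⟩
  have := congrArg (MvPowerSeries.coeff (d.mapRange (· / p) (Nat.zero_div p))) h0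
  rw [coeff_cartier, map_zero] at this
  have hd' : p • d.mapRange (· / p) (Nat.zero_div p) + d.mapRange (· % p) (Nat.zero_mod p) = d := by
    ext i
    simp [Nat.div_add_mod]
  rwa [hd'] at this

/-- The field of fractions of the power series ring is separable over that of the polynomial
ring. -/
theorem linearIndepOn_pow (p : ℕ) [hp : Fact p.Prime] [CharP K p] (L Q : Type) [Field L] [Field Q]
    [Algebra (MvPolynomial (Fin N) K) L] [IsFractionRing (MvPolynomial (Fin N) K) L]
    [Algebra (MvPowerSeries (Fin N) K) Q] [IsFractionRing (MvPowerSeries (Fin N) K) Q]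
    [Algebra L Q] [Algebra (MvPolynomial (Fin N) K) Q]
    [IsScalarTower (MvPolynomial (Fin N) K) L Q]
    [IsScalarTower (MvPolynomial (Fin N) K) (MvPowerSeries (Fin N) K) Q] (s : Finset Q)
    (hs : LinearIndepOn L id (s : Set Q)) : LinearIndepOn L (· ^ p) (s : Set Q) := by
  classical
  rw [linearIndepOn_finset_iff] at hs ⊢
  intro c hc i hi
  obtain ⟨D, hD⟩ := IsLocalization.exist_integer_multiples (nonZeroDivisors
    (MvPowerSeries (Fin N) K)) s (id : Q → Q)
  obtain ⟨B, hB⟩ := IsLocalization.exist_integer_multiples (nonZeroDivisors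
    (MvPolynomial (Fin N) K)) s c
  choose! f hf using hD
  choose! a ha using hB
  have hB0 : algebraMap _ L (B : MvPolynomial (Fin N) K) ≠ 0 := by
    simp
  have hD0 : algebraMap _ Q (D : MvPowerSeries (Fin N) K) ≠ 0 := by
    simp
  have hcoe (r : MvPolynomial (Fin N) K) : algebraMap _ Q (r : MvPowerSeries (Fin N) K) =
      algebraMap L Q (algebraMap _ L r) :=
    (IsScalarTower.algebraMap_apply (MvPolynomial (Fin N) K)
      (MvPowerSeries (Fin N) K) Q r).symm.trans
      (IsScalarTower.algebraMap_apply (MvPolynomial (Fin N) K) L Q r)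
  have hz : ∑ q ∈ s, f q ^ p * (a q : MvPowerSeries (Fin N) K) = 0 := by
    apply IsFractionRing.injective (MvPowerSeries (Fin N) K) Q
    rw [map_zero, map_sum]
    have := congrArg (fun x ↦ algebraMap L Q (algebraMap _ L (B : MvPolynomial (Fin N) K)) *
      algebraMap _ Q (D : MvPowerSeries (Fin N) K) ^ p * x) hc
    simp only [mul_zero, Finset.mul_sum] at this
    refine Eq.trans (Finset.sum_congr rfl fun q hq ↦ ?_) this
    have e1 := hcoe (a q)
    rw [map_mul, map_pow, e1, hf q hq, ha q hq, Algebra.smul_def, Algebra.smul_def, map_mul,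
      Algebra.smul_def, id]
    ring
  by_contra hci
  have hai : (a i : MvPowerSeries (Fin N) K) ≠ 0 := by
    intro h0
    have h1 := ha i hi
    rw [MvPolynomial.coe_eq_zero_iff.mp h0, map_zero, Algebra.smul_def] at h1
    exact mul_ne_zero hB0 hci h1.symm
  obtain ⟨ν, ℓ, hν, hℓ, hne⟩ := exists_cartier_ne_zero p _ hai
  choose b hb using exists_cartier_coe (N := N) p ν ℓ
  have h2 := congrArg (cartier p ν ℓ) hz
  rw [map_sum, map_zero] at h2
  simp only [cartier_pow_mul p ν hν ℓ hℓ, ← hb] at h2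
  refine hne ?_
  rw [← hb]
  have h3 := hs (fun q ↦ algebraMap _ L (b (a q))) ?_ i hi
  · rw [(map_eq_zero_iff _ (IsFractionRing.injective (MvPolynomial (Fin N) K) L)).mp h3]
    exact MvPolynomial.coe_zero
  · have h4 := congrArg (algebraMap _ Q) h2
    rw [map_sum, map_zero] at h4
    refine mul_left_cancel₀ hD0 ?_
    rw [mul_zero, Finset.mul_sum, ← h4]
    refine Finset.sum_congr rfl fun q hq ↦ ?_
    rw [map_mul, hf q hq, Algebra.smul_def, Algebra.smul_def, hcoe]
    simp only [id]
    ring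

end Cartier

open IntermediateField in
theorem exists_separating {k F τ : Type} [Field k] [Field F] [Algebra k F] [Finite τ] (a : τ → F)
    (ha : adjoin k (Set.range a) = ⊤)
    (H : ∀ p : ℕ, p.Prime → CharP k p → ∀ s : Finset F, LinearIndepOn k id (s : Set F) →
      LinearIndepOn k (· ^ p) (s : Set F)) :
    ∃ t : Set τ, IsTranscendenceBasis k (fun i : t ↦ a i) ∧
      ∀ j, IsSeparable (adjoin k (a '' t)) (a j) := by
  classical
  have halg : Algebra.IsAlgebraic (Algebra.adjoin k (Set.range a)) F := by
    rw [← isAlgebraic_adjoin_iff_top, ha, Algebra.isAlgebraic_iff_isIntegral]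
    exact Algebra.isIntegral_of_surjective topEquiv.surjective
  have hne : {t : Set τ | IsTranscendenceBasis k (fun i : t ↦ a i)}.Nonempty := by
    obtain ⟨t', ht', hb⟩ := exists_isTranscendenceBasis_subset (R := k) (Set.range a)
    obtain ⟨t, -, ht⟩ := Set.exists_subset_bijOn (a ⁻¹' t') a
    rw [Set.image_preimage_eq_of_subset ht'] at ht
    exact ⟨t, hb.comp_equiv (ht.equiv a)⟩
  obtain ⟨t, ht, hmax⟩ := (Set.toFinite
    {t : Set τ | IsTranscendenceBasis k (fun i : t ↦ a i)}).exists_maximalFor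
      (fun t ↦ {j | IsSeparable (adjoin k (a '' t)) (a j)}) _ hne
  refine ⟨t, ht, ?_⟩
  obtain _ | ⟨p, hp, hpk⟩ := CharP.exists' k
  · intro j
    have : Algebra.IsAlgebraic (adjoin k (a '' t)) F := by
      have := IsTranscendenceBasis.isAlgebraic_field ht
      rwa [← Set.image_eq_range] at this
    exact Algebra.IsSeparable.isSeparable _ _
  have : ExpChar k p := .prime hp.out
  have hself : ∀ (t : Set τ) (j), j ∈ t → IsSeparable (adjoin k (a '' t)) (a j) := fun t j hj ↦
    isSeparable_algebraMap (F := adjoin k (a '' t)) ⟨_, subset_adjoin _ _ ⟨j, hj, rfl⟩⟩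
  by_contra! hn
  obtain ⟨n, hn⟩ := hn
  have hns : n ∉ t := fun h ↦ hn (hself t n h)
  obtain ⟨i, hi₁, hi₂⟩ := exists_isTranscendenceBasis_and_isSeparable_of_linearIndepOn_pow'
    p hp.out (H p hp.out hpk) t n ht hns
  have hins : ∀ j ∈ insert n t, IsSeparable (adjoin k (a '' (insert n t \ {i}))) (a j) := by
    intro j hj
    obtain rfl | hne := eq_or_ne j i
    · exact hi₂
    · exact hself _ _ ⟨hj, hne⟩
  have hle : (separableClosure (adjoin k (a '' t)) F).restrictScalars k ≤
      (separableClosure (adjoin k (a '' (insert n t \ {i}))) F).restrictScalars k := by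
    rw [separableClosure_le_separableClosure_iff, adjoin_le_iff]
    rintro _ ⟨j, hj, rfl⟩
    exact hins j (.inr hj)
  exact hn (hmax hi₁ (fun j hj ↦ hle hj) (hins n (.inl rfl)))

open IntermediateField Polynomial in
theorem exists_presentation_of_isSeparable {R M FS Q τ : Type} [CommRing R] [IsDomain R]
    [CommRing M] [IsDomain M] [Field FS] [Field Q] [Algebra R FS] [IsFractionRing R FS]
    [Algebra M Q] [IsFractionRing M Q] [Algebra R M] [Algebra R Q] [IsScalarTower R M Q]
    [Algebra FS Q] [IsScalarTower R FS Q] [Finite τ] (y : τ → M)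
    (hy : ∀ j, IsSeparable FS (algebraMap M Q (y j))) :
    ∃ (θ : M) (g : R[X]) (b : R) (a : τ → R[X]), aeval θ g = 0 ∧ aeval θ (derivative g) ≠ 0 ∧
      b ≠ 0 ∧ (∀ j, algebraMap R M b * y j = aeval θ (a j)) ∧
      ∀ F : R[X], aeval θ F = 0 → ∃ s ≠ 0, g ∣ C s * F := by
  classical
  have := Fintype.ofFinite τ
  set yQ := fun j ↦ algebraMap M Q (y j) with hyQ
  have hinjM := IsFractionRing.injective M Q
  have hinjR := IsFractionRing.injective R FS
  have hint : ∀ j, IsIntegral FS (yQ j) := fun j ↦ (hy j).isIntegral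
  have hfin : FiniteDimensional FS (adjoin FS (Set.range yQ)) :=
    finiteDimensional_adjoin (by rintro _ ⟨j, rfl⟩; exact hint j)
  have hsep : Algebra.IsSeparable FS (adjoin FS (Set.range yQ)) :=
    (isSeparable_adjoin_iff_isSeparable FS Q).mpr (by rintro _ ⟨j, rfl⟩; exact hy j)
  obtain ⟨α, hα⟩ := Field.exists_primitive_element FS (adjoin FS (Set.range yQ))
  have hP : ∀ j, ∃ P : FS[X], aeval (α : Q) P = yQ j := by
    intro j
    have h1 : (⟨yQ j, subset_adjoin _ _ ⟨j, rfl⟩⟩ : adjoin FS (Set.range yQ)) ∈ FS⟮α⟯ := by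
      rw [hα]; trivial
    rw [← mem_toSubalgebra, adjoin_simple_toSubalgebra_of_isAlgebraic (IsAlgebraic.of_finite FS α),
      Algebra.adjoin_singleton_eq_range_aeval] at h1
    obtain ⟨P, hP⟩ := h1
    refine ⟨P, ?_⟩
    have h2 := congrArg Subtype.val hP
    simpa using h2
  have hd : ∀ z ∈ Algebra.adjoin FS (Set.range yQ),
      ∃ d : R, d ≠ 0 ∧ ∃ m : M, algebraMap R Q d * z = algebraMap M Q m := by
    intro z hz
    induction hz using Algebra.adjoin_induction with
    | mem x hx =>
      obtain ⟨j, rfl⟩ := hx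
      exact ⟨1, one_ne_zero, y j, by simp [hyQ]⟩
    | algebraMap r =>
      obtain ⟨x, d, hd, rfl⟩ := IsFractionRing.div_surjective (A := R) r
      have hd0 := nonZeroDivisors.ne_zero hd
      refine ⟨d, hd0, algebraMap R M x, ?_⟩
      rw [IsScalarTower.algebraMap_apply R FS Q, ← map_mul, mul_div_cancel₀,
        ← IsScalarTower.algebraMap_apply, ← IsScalarTower.algebraMap_apply]
      exact (map_ne_zero_iff _ hinjR).mpr hd0
    | add x z _ _ h1 h2 =>
      obtain ⟨d, hd, m, hm⟩ := h1
      obtain ⟨e, he, n, hn⟩ := h2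
      refine ⟨d * e, mul_ne_zero hd he, algebraMap R M e * m + algebraMap R M d * n, ?_⟩
      rw [map_add, map_mul, map_mul, map_mul, ← hm, ← hn, ← IsScalarTower.algebraMap_apply,
        ← IsScalarTower.algebraMap_apply]
      ring
    | mul x z _ _ h1 h2 =>
      obtain ⟨d, hd, m, hm⟩ := h1
      obtain ⟨e, he, n, hn⟩ := h2
      refine ⟨d * e, mul_ne_zero hd he, m * n, ?_⟩
      rw [map_mul, map_mul, ← hm, ← hn]
      ring
  obtain ⟨d, hd0, θ, hθ⟩ := hd α (by
    rw [← adjoin_toSubalgebra_of_isAlgebraic]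
    · exact α.2
    · rintro _ ⟨j, rfl⟩
      exact (hint j).isAlgebraic)
  have hdFS : algebraMap R FS d ≠ 0 := (map_ne_zero_iff _ hinjR).mpr hd0
  set θQ := algebraMap M Q θ with hθQ
  have hθα : θQ = algebraMap FS Q (algebraMap R FS d) * α := by
    rw [← hθ, ← IsScalarTower.algebraMap_apply]
  have hsepθ : IsSeparable FS θQ := by
    have h1 : θQ = ((algebraMap R FS d • α : adjoin FS (Set.range yQ)) : Q) := by
      rw [hθα, IntermediateField.coe_smul, Algebra.smul_def]
    rw [h1, IsSeparable, ← IntermediateField.minpoly_eq]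
    exact Algebra.IsSeparable.isSeparable FS _
  have hmap : ∀ p : R[X], algebraMap M Q (aeval θ p) = aeval θQ (p.map (algebraMap R FS)) := by
    intro p
    rw [aeval_map_algebraMap, aeval_algebraMap_apply]
  have hnorm : ∀ p : FS[X], ∃ (c : R) (q : R[X]), c ≠ 0 ∧
      q.map (algebraMap R FS) = C (algebraMap R FS c) * p := by
    intro p
    obtain ⟨c, hc0, hc⟩ := IsLocalization.integerNormalization_spec (nonZeroDivisors R) p
    refine ⟨c, _, nonZeroDivisors.ne_zero hc0, hc.trans ?_⟩
    rw [Algebra.smul_def]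
    rfl
  obtain ⟨c, g, hc, hg⟩ := hnorm (minpoly FS θQ)
  have hcFS : algebraMap R FS c ≠ 0 := (map_ne_zero_iff _ hinjR).mpr hc
  choose P hP using hP
  choose e a he ha using fun j ↦ hnorm ((P j).comp (C (algebraMap R FS d)⁻¹ * X))
  refine ⟨θ, g, ∏ j, e j, fun j ↦ C (∏ i ∈ Finset.univ.erase j, e i) * a j, hinjM ?_, ?_,
    Finset.prod_ne_zero_iff.mpr fun j _ ↦ he j, fun j ↦ hinjM ?_, fun F hF ↦ ?_⟩
  · rw [hmap, hg, map_mul, minpoly.aeval, mul_zero, map_zero]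
  · refine fun h0 ↦ hsepθ.aeval_derivative_ne_zero (minpoly.aeval FS θQ) ?_
    have h1 := congrArg (algebraMap M Q) h0
    rw [hmap, ← derivative_map, hg, derivative_C_mul, map_mul, aeval_C, map_zero] at h1
    exact (mul_eq_zero.mp h1).resolve_left
      ((map_ne_zero_iff _ (algebraMap FS Q).injective).mpr hcFS)
  · rw [hmap, Polynomial.map_mul, map_C, ha, aeval_mul, aeval_mul, aeval_C, aeval_C,
      aeval_comp]
    have h1 : aeval θQ (C (algebraMap R FS d)⁻¹ * X) = (α : Q) := by
      rw [map_mul, aeval_C, aeval_X, hθα, ← mul_assoc, ← map_mul, inv_mul_cancel₀ hdFS, map_one,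
        one_mul]
    rw [h1, hP, ← mul_assoc, ← map_mul, ← map_mul, Finset.prod_erase_mul _ _ (Finset.mem_univ j),
      ← IsScalarTower.algebraMap_apply, map_mul, ← IsScalarTower.algebraMap_apply R M Q]
  · have h1 := hmap F
    rw [hF, map_zero] at h1
    obtain ⟨h, hh⟩ := minpoly.dvd FS θQ h1.symm
    obtain ⟨e', q, he', hq⟩ := hnorm h
    refine ⟨c * e', mul_ne_zero hc he', q, map_injective _ hinjR ?_⟩
    rw [Polynomial.map_mul, Polynomial.map_mul, hg, hq, hh, map_C, map_mul, C_mul]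
    ring

theorem isSeparable_of_forall_exists {E F FS Q : Type} [Field E] [Field F] [Algebra E F]
    [Field Q] [Field FS] [Algebra FS Q] (i : F →+* Q)
    (h : ∀ r : E, ∃ f, algebraMap FS Q f = i (algebraMap E F r)) {x : F} (hx : IsSeparable E x) :
    IsSeparable FS (i x) := by
  have hl : (minpoly E x).map (i.comp (algebraMap E F)) ∈ Polynomial.lifts (algebraMap FS Q) := by
    rw [Polynomial.lifts_iff_coeff_lifts]
    intro n
    rw [Polynomial.coeff_map]
    obtain ⟨f, hf⟩ := h ((minpoly E x).coeff n)
    exact ⟨f, hf⟩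
  obtain ⟨q, hq⟩ := hl
  rw [Polynomial.coe_mapRingHom] at hq
  have hq1 : q.Separable := by
    rw [← Polynomial.separable_map (algebraMap FS Q), hq]
    exact Polynomial.Separable.map hx
  refine hq1.of_dvd (minpoly.dvd _ _ ?_)
  rw [← Polynomial.aeval_map_algebraMap Q, hq, Polynomial.coe_aeval_eq_eval,
    ← Polynomial.map_map, Polynomial.eval_map_apply, Polynomial.eval_map_algebraMap,
    minpoly.aeval, map_zero]

theorem linearIndepOn_pow_of_injective {L E Q : Type} [Field L] [Field E] [Field Q] [Algebra L E]
    [Algebra L Q] (i : E →ₐ[L] Q) (p : ℕ)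
    (H : ∀ s : Finset Q, LinearIndepOn L id (s : Set Q) → LinearIndepOn L (· ^ p) (s : Set Q))
    (s : Finset E) (hs : LinearIndepOn L id (s : Set E)) :
    LinearIndepOn L (· ^ p) (s : Set E) := by
  classical
  have hi : Function.Injective i := i.injective
  have hker : LinearMap.ker i.toLinearMap = ⊥ := LinearMap.ker_eq_bot.mpr hi
  have h1 : LinearIndepOn L (i.toLinearMap ∘ id) (s : Set E) :=
    hs.map_injOn _ hi.injOn
  have h2 := H (s.image i) (by
    rw [Finset.coe_image]
    exact h1.id_image)
  rw [Finset.coe_image] at h2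
  have h3 := (h2.comp_of_image hi.injOn)
  have h4 : LinearIndepOn L (i.toLinearMap ∘ (· ^ p)) (s : Set E) := by
    convert h3 using 1
    ext x
    exact map_pow i x p
  exact h4.of_comp _

open IntermediateField in
theorem exists_separating_subset {L Q τ : Type} [Field L] [Field Q] [Algebra L Q] [Finite τ]
    (a : τ → Q) (H : ∀ p : ℕ, p.Prime → CharP L p → ∀ s : Finset Q,
      LinearIndepOn L id (s : Set Q) → LinearIndepOn L (· ^ p) (s : Set Q)) :
    ∃ t : Set τ, AlgebraicIndependent L (fun i : t ↦ a i) ∧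
      ∀ (FS : Type) [Field FS] [Algebra FS Q],
        (∀ x : L, ∃ f, algebraMap FS Q f = algebraMap L Q x) →
        (∀ j ∈ t, ∃ f, algebraMap FS Q f = a j) → ∀ j, IsSeparable FS (a j) := by
  obtain ⟨E, _, _, i, a', ha', rfl⟩ : ∃ (E : Type) (_ : Field E) (_ : Algebra L E) (i : E →ₐ[L] Q)
      (a' : τ → E), adjoin L (Set.range a') = ⊤ ∧ i ∘ a' = a := by
    refine ⟨adjoin L (Set.range a), inferInstance, inferInstance, val _,
      fun j ↦ ⟨a j, subset_adjoin _ _ ⟨j, rfl⟩⟩, ?_, rfl⟩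
    apply IntermediateField.map_injective (val _)
    rw [adjoin_map, ← Set.range_comp, ← AlgHom.fieldRange_eq_map, fieldRange_val]
    rfl
  obtain ⟨t, ht, hsep⟩ := exists_separating a' ha'
    (fun p hp hchar ↦ linearIndepOn_pow_of_injective i p (H p hp hchar))
  refine ⟨t, (i.algebraicIndependent_iff i.injective).mpr ht.1, fun FS _ _ hL ht' j ↦
    isSeparable_of_forall_exists (E := adjoin L (a' '' t)) i.toRingHom ?_ (hsep j)⟩
  rintro ⟨r, hr⟩
  change ∃ f, algebraMap FS Q f = i r
  induction hr using adjoin_induction with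
  | mem x hx =>
    obtain ⟨l, hl, rfl⟩ := hx
    exact ht' l hl
  | algebraMap x =>
    obtain ⟨f, hf⟩ := hL x
    exact ⟨f, by rw [hf, i.commutes]⟩
  | add x y _ _ h1 h2 =>
    obtain ⟨f, hf⟩ := h1
    obtain ⟨g, hg⟩ := h2
    exact ⟨f + g, by rw [map_add, map_add, hf, hg]⟩
  | inv x _ h1 =>
    obtain ⟨f, hf⟩ := h1
    exact ⟨f⁻¹, by rw [map_inv₀, map_inv₀, hf]⟩
  | mul x y _ _ h1 h2 =>
    obtain ⟨f, hf⟩ := h1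
    obtain ⟨g, hg⟩ := h2
    exact ⟨f * g, by rw [map_mul, map_mul, hf, hg]⟩

/-- For finitely many power series, choose among them a separating transcendence basis over the
field of rational functions and a primitive integral generator of the remaining extension. -/
theorem exists_generic_presentation {K τ : Type} [Field K] [Finite τ] {N : ℕ}
    (yhat : τ → MvPowerSeries (Fin N) K) :
    ∃ (σ : Type) (_ : Finite σ) (u : σ → MvPowerSeries (Fin N) K) (θ : MvPowerSeries (Fin N) K)
      (ev : MvPolynomial (Fin N ⊕ σ) K →ₐ[K] MvPowerSeries (Fin N) K)
      (g : Polynomial (MvPolynomial (Fin N ⊕ σ) K)) (b : MvPolynomial (Fin N ⊕ σ) K)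
      (a : τ → Polynomial (MvPolynomial (Fin N ⊕ σ) K)),
      ev = MvPolynomial.aeval (Sum.elim MvPowerSeries.X u) ∧ Function.Injective ev ∧
      g.eval₂ ev.toRingHom θ = 0 ∧ (Polynomial.derivative g).eval₂ ev.toRingHom θ ≠ 0 ∧ b ≠ 0 ∧
      (∀ j, ev b * yhat j = (a j).eval₂ ev.toRingHom θ) ∧
      ∀ F : Polynomial (MvPolynomial (Fin N ⊕ σ) K), F.eval₂ ev.toRingHom θ = 0 →
        ∃ s ≠ 0, g ∣ Polynomial.C s * F := by
  classical
  have hinj : Function.Injective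
      (algebraMap (MvPolynomial (Fin N) K) (MvPowerSeries (Fin N) K)) := by
    intro p q h
    rw [MvPowerSeries.algebraMap_apply', MvPowerSeries.algebraMap_apply'] at h
    simpa using h
  have : FaithfulSMul (MvPolynomial (Fin N) K) (MvPowerSeries (Fin N) K) :=
    (faithfulSMul_iff_algebraMap_injective _ _).mpr hinj
  have hinjQ := IsFractionRing.injective (MvPowerSeries (Fin N) K)
    (FractionRing (MvPowerSeries (Fin N) K))
  have : FaithfulSMul (MvPolynomial (Fin N) K) (FractionRing (MvPowerSeries (Fin N) K)) := by
    rw [faithfulSMul_iff_algebraMap_injective, IsScalarTower.algebraMap_eq _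
      (MvPowerSeries (Fin N) K)]
    exact hinjQ.comp hinj
  let _ : Algebra (FractionRing (MvPolynomial (Fin N) K))
    (FractionRing (MvPowerSeries (Fin N) K)) := FractionRing.liftAlgebra _ _
  obtain ⟨t, ht, hsep⟩ := exists_separating_subset
    (L := FractionRing (MvPolynomial (Fin N) K)) (Q := FractionRing (MvPowerSeries (Fin N) K))
    (fun j ↦ algebraMap _ _ (yhat j)) (by
      intro p hp hchar s hs
      have : Fact p.Prime := ⟨hp⟩
      have : CharP K p := ((algebraMap K (FractionRing (MvPolynomial (Fin N) K))).charP_iff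
        (algebraMap K _).injective p).mpr hchar
      exact linearIndepOn_pow (K := K) (N := N) p _ _ s hs)
  have ht1 : AlgebraicIndependent (MvPolynomial (Fin N) K) (fun i : t ↦ yhat i) :=
    AlgebraicIndependent.of_comp (IsScalarTower.toAlgHom (MvPolynomial (Fin N) K)
      (MvPowerSeries (Fin N) K) (FractionRing (MvPowerSeries (Fin N) K)))
      (ht.restrictScalars (IsFractionRing.injective (MvPolynomial (Fin N) K)
        (FractionRing (MvPolynomial (Fin N) K))))
  have ht2 := AlgebraicIndependent.sumElim_comp (R := K) (S := MvPolynomial (Fin N) K)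
    (MvPolynomial.algebraicIndependent_X (Fin N) K) ht1
  have hev : Function.Injective (MvPolynomial.aeval (R := K)
      (Sum.elim MvPowerSeries.X (fun i : t ↦ yhat i))) := by
    have h3 : AlgebraicIndependent K
        (Sum.elim (MvPowerSeries.X (R := K)) (fun i : t ↦ yhat i)) := by
      convert ht2.comp Sum.swap Sum.swap_leftInverse.injective using 1
      ext1 (i | i)
      · simp [MvPowerSeries.algebraMap_apply']
      · simp
    exact h3
  set ev := MvPolynomial.aeval (R := K) (Sum.elim MvPowerSeries.X (fun i : t ↦ yhat i)) with hev'
  let _ : Algebra (MvPolynomial (Fin N ⊕ t) K) (MvPowerSeries (Fin N) K) := ev.toRingHom.toAlgebra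
  have hinjR : Function.Injective (algebraMap (MvPolynomial (Fin N ⊕ t) K)
      (FractionRing (MvPowerSeries (Fin N) K))) := by
    rw [IsScalarTower.algebraMap_eq _ (MvPowerSeries (Fin N) K)]
    exact hinjQ.comp hev
  have : FaithfulSMul (MvPolynomial (Fin N ⊕ t) K) (FractionRing (MvPowerSeries (Fin N) K)) :=
    (faithfulSMul_iff_algebraMap_injective _ _).mpr hinjR
  let _ : Algebra (FractionRing (MvPolynomial (Fin N ⊕ t) K))
    (FractionRing (MvPowerSeries (Fin N) K)) := FractionRing.liftAlgebra _ _
  have hx : ∀ x : MvPolynomial (Fin N) K, ∃ r : MvPolynomial (Fin N ⊕ t) K,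
      ev r = algebraMap _ _ x := by
    intro x
    refine ⟨MvPolynomial.rename Sum.inl x, ?_⟩
    rw [hev', MvPolynomial.aeval_rename, Sum.elim_comp_inl]
    have h := MvPolynomial.aeval_unique
      (IsScalarTower.toAlgHom K (MvPolynomial (Fin N) K) (MvPowerSeries (Fin N) K))
    refine Eq.trans ?_ (DFunLike.congr_fun h x).symm
    congr 2
    ext1 i
    simp [MvPowerSeries.algebraMap_apply']
  obtain ⟨θ, g, b, a, h1, h2, h3, h4, h5⟩ := exists_presentation_of_isSeparable
    (FS := FractionRing (MvPolynomial (Fin N ⊕ t) K))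
    (R := MvPolynomial (Fin N ⊕ t) K) (Q := FractionRing (MvPowerSeries (Fin N) K)) yhat
    (hsep _ (fun x ↦ by
      obtain ⟨p, q, hq, rfl⟩ := IsFractionRing.div_surjective (A := MvPolynomial (Fin N) K) x
      obtain ⟨p', hp'⟩ := hx p
      obtain ⟨q', hq'⟩ := hx q
      refine ⟨algebraMap _ _ p' / algebraMap _ _ q', ?_⟩
      rw [map_div₀, map_div₀, ← IsScalarTower.algebraMap_apply, ← IsScalarTower.algebraMap_apply,
        ← IsScalarTower.algebraMap_apply, ← IsScalarTower.algebraMap_apply,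
        IsScalarTower.algebraMap_apply _ (MvPowerSeries (Fin N) K),
        IsScalarTower.algebraMap_apply _ (MvPowerSeries (Fin N) K),
        IsScalarTower.algebraMap_apply _ (MvPowerSeries (Fin N) K) _ p,
        IsScalarTower.algebraMap_apply _ (MvPowerSeries (Fin N) K) _ q, ← hp', ← hq']
      rfl) fun j hj ↦ by
      refine ⟨algebraMap (MvPolynomial (Fin N ⊕ t) K) _ (MvPolynomial.X (Sum.inr ⟨j, hj⟩)), ?_⟩
      rw [← IsScalarTower.algebraMap_apply, IsScalarTower.algebraMap_apply _
        (MvPowerSeries (Fin N) K)]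
      congr 1
      exact (MvPolynomial.aeval_X _ _).trans rfl)
  exact ⟨t, inferInstance, _, θ, ev, g, b, a, hev', hev, h1, h2, h3, h4, h5⟩

theorem exists_homogenization {K R : Type} [Field K] [CommRing R] [Algebra K R] {ν τ : Type}
    (x : ν → R) (a : τ → R) (b : R) (f : MvPolynomial (ν ⊕ τ) K) :
    ∃ (N : ℕ) (F : R), ∀ (T : Type) [CommRing T] [Algebra K T] (ψ : R →ₐ[K] T) (y : τ → T),
      (∀ j, ψ b * y j = ψ (a j)) →
      ψ F = ψ b ^ N * MvPolynomial.aeval (Sum.elim (fun i ↦ ψ (x i)) y) f := by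
  induction f using MvPolynomial.induction_on with
  | C c =>
    refine ⟨0, algebraMap K R c, fun T _ _ ψ y _ ↦ ?_⟩
    rw [AlgHom.commutes, MvPolynomial.aeval_C, pow_zero, one_mul]
  | add p q hp hq =>
    obtain ⟨N, F, h⟩ := hp
    obtain ⟨M, G, h'⟩ := hq
    refine ⟨N + M, b ^ M * F + b ^ N * G, fun T _ _ ψ y hy ↦ ?_⟩
    rw [map_add, map_mul, map_mul, h T ψ y hy, h' T ψ y hy, map_pow, map_pow, map_add]
    ring
  | mul_X p i hp =>
    obtain ⟨N, F, h⟩ := hp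
    rcases i with i | j
    · refine ⟨N, F * x i, fun T _ _ ψ y hy ↦ ?_⟩
      rw [map_mul, h T ψ y hy, map_mul, MvPolynomial.aeval_X, Sum.elim_inl, mul_assoc]
    · refine ⟨N + 1, F * a j, fun T _ _ ψ y hy ↦ ?_⟩
      rw [map_mul, h T ψ y hy, map_mul, MvPolynomial.aeval_X, Sum.elim_inr, ← hy]
      ring

/-- A quantitative Newton step. -/
theorem ApproxSystem.exists_root {K : Type} [Field K] (S : ApproxSystem K) {n : ℕ}
    (g : Polynomial (S.A n)) (z b t q : S.A n) (c : ℕ)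
    (ht : MvPowerSeries.constantCoeff (S.π n t) = 0)
    (h : g.eval z = (g.derivative.eval z * b) ^ 2 * t ^ (c + 1) * q) :
    ∃ v, g.eval (z + g.derivative.eval z * b ^ 2 * t ^ c * v) = 0 := by
  set d := g.derivative.eval z with hd
  set T := Polynomial.taylor z g with hT
  have h0 : T.coeff 0 = g.eval z := Polynomial.taylor_coeff_zero z g
  have h1 : T.coeff 1 = d := Polynomial.taylor_coeff_one z g
  have hT' : T = T.divX.divX * Polynomial.X ^ 2 + Polynomial.C d * Polynomial.X +
      Polynomial.C (g.eval z) := by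
    conv_lhs => rw [← Polynomial.divX_mul_X_add T, ← Polynomial.divX_mul_X_add T.divX,
      Polynomial.coeff_divX, h0, zero_add, h1]
    ring
  obtain ⟨v, hv⟩ := S.hensel n (Polynomial.C (t * q) + Polynomial.X +
    Polynomial.C (b ^ 2 * t ^ c) * (Polynomial.X ^ 2 *
      T.divX.divX.comp (Polynomial.C (d * b ^ 2 * t ^ c) * Polynomial.X)))
    (by simp [ht]) (by
      rw [Polynomial.coeff_add, Polynomial.coeff_add, Polynomial.coeff_C_mul,
        Polynomial.coeff_X_pow_mul', Polynomial.coeff_X_one, Polynomial.coeff_C]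
      simp)
  refine ⟨v, ?_⟩
  have h2 : g.eval (z + d * b ^ 2 * t ^ c * v) = T.eval (d * b ^ 2 * t ^ c * v) := by
    rw [hT, Polynomial.taylor_eval, add_comm]
  rw [h2, hT', h]
  simp only [Polynomial.eval_add, Polynomial.eval_mul, Polynomial.eval_pow, Polynomial.eval_X,
    Polynomial.eval_C, Polynomial.eval_comp] at hv ⊢
  linear_combination d ^ 2 * b ^ 2 * t ^ c * hv

section

variable {K : Type} [Field K] {ν σ τ : Type}

/-- A polynomial in one variable over a polynomial ring, seen in more variables. -/
noncomputable def flatten (τ : Type) (p : Polynomial (MvPolynomial (ν ⊕ σ) K)) :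
    MvPolynomial (ν ⊕ (Option σ ⊕ τ)) K :=
  p.eval₂ (MvPolynomial.rename (Sum.map id (Sum.inl ∘ some))).toRingHom
    (MvPolynomial.X (Sum.inr (Sum.inl none)))

theorem aeval_flatten {T : Type} [CommRing T] [Algebra K T] (x : ν → T) (w : Option σ ⊕ τ → T)
    (p : Polynomial (MvPolynomial (ν ⊕ σ) K)) :
    MvPolynomial.aeval (Sum.elim x w) (flatten τ p) =
      p.eval₂ (MvPolynomial.aeval (Sum.elim x (fun i ↦ w (Sum.inl (some i))))).toRingHom
        (w (Sum.inl none)) := by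
  change (MvPolynomial.aeval (Sum.elim x w)).toRingHom (flatten τ p) = _
  rw [flatten, Polynomial.hom_eval₂]
  congr 1
  · refine MvPolynomial.ringHom_ext (fun r ↦ ?_) ?_
    · simp
    · rintro (i | i) <;> simp
  · simp

end

set_option maxHeartbeats 400000 in
theorem Approximable.succ {K : Type} [Field K] {S : ApproxSystem K} {n : ℕ}
    (hS : Approximable S n) : Approximable S (n + 1) := by
  classical
  intro τ ι _ _ f yhat hf α
  have := Fintype.ofFinite ι
  obtain ⟨σ, _, û, θ, ev, g, b, a, hev, hinj, hg, hg', hb, ha, hdvd⟩ :=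
    exists_generic_presentation yhat
  choose N F hF using fun i ↦ exists_homogenization
    (fun i ↦ Polynomial.C (MvPolynomial.X (Sum.inl i))) a (Polynomial.C b) (f i)
  have hFθ : ∀ i, (F i).eval₂ ev.toRingHom θ = 0 := by
    intro i
    let ψ := Polynomial.eval₂AlgHom ev θ (fun _ ↦ mul_comm _ _)
    have hψC : ∀ p, ψ (Polynomial.C p) = ev p := fun p ↦ Polynomial.eval₂_C _ _
    have h1 := hF i _ ψ yhat (fun j ↦ by rw [hψC]; exact ha j)
    refine h1.trans ?_
    rw [← mul_zero (ψ (Polynomial.C b) ^ N i), ← hf i]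
    congr 4
    ext1 i
    rw [hψC, hev, MvPolynomial.aeval_X]
    rfl
  choose s hs0 hs using fun i ↦ hdvd (F i) (hFθ i)
  have hP : ev (b * ∏ i, s i) ≠ 0 := (map_ne_zero_iff ev hinj).mpr
    (mul_ne_zero hb (Finset.prod_ne_zero_iff.mpr fun i _ ↦ hs0 i))
  obtain ⟨N₀, hN₀⟩ := exists_notMem_J_pow hP
  set c := α + N₀ with hc
  let w : Option σ ⊕ τ → MvPowerSeries (Fin (n + 1)) K :=
    Sum.elim (fun o ↦ o.elim θ û) yhat
  have hw : ∀ p, MvPolynomial.aeval (Sum.elim MvPowerSeries.X w) (flatten τ p) =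
      p.eval₂ ev.toRingHom θ := fun p ↦ by
    rw [aeval_flatten, hev]
    rfl
  obtain ⟨y₁, hy₁, hq⟩ := hS.exists_approx (ι := Option τ)
    (fun o ↦ o.elim (flatten τ g) fun j ↦ flatten τ (Polynomial.C b) *
      MvPolynomial.X (Sum.inr (Sum.inr j)) - flatten τ (a j))
    (flatten τ (Polynomial.derivative g * Polynomial.C b)) w
    (by
      rintro (_ | j)
      · exact (hw g).trans hg
      · change MvPolynomial.aeval _ (_ - _) = 0
        rw [map_sub, map_mul, hw, hw, MvPolynomial.aeval_X, Polynomial.eval₂_C, ← ha]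
        exact sub_self _)
    (by
      rw [hw, Polynomial.eval₂_mul, Polynomial.eval₂_C]
      exact mul_ne_zero hg' ((map_ne_zero_iff ev hinj).mpr hb)) (c + 1) c.succ_ne_zero
  set u : σ → S.A (n + 1) := fun i ↦ y₁ (Sum.inl (some i)) with hu
  set z := y₁ (Sum.inl none) with hz
  set t := S.X (n + 1) 0 with ht
  set evA := MvPolynomial.aeval (R := K) (Sum.elim (S.X (n + 1)) u) with hevA
  have hfl : ∀ p, MvPolynomial.aeval (Sum.elim (S.X (n + 1)) y₁) (flatten τ p) =
      (p.map evA.toRingHom).eval z := fun p ↦ by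
    rw [aeval_flatten, Polynomial.eval_map]
  set G := g.map evA.toRingHom with hG
  set B := evA b with hB
  have hD : MvPolynomial.aeval (Sum.elim (S.X (n + 1)) y₁)
      (flatten τ (Polynomial.derivative g * Polynomial.C b)) = G.derivative.eval z * B := by
    rw [hfl, Polynomial.map_mul, Polynomial.eval_mul, ← Polynomial.derivative_map,
      Polynomial.map_C, Polynomial.eval_C]
    rfl
  rw [hD] at hq
  obtain ⟨q₀, hq₀⟩ := hq none
  choose q hq using fun j ↦ hq (some j)
  obtain ⟨v, hv⟩ := S.exists_root G z B t q₀ c (by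
    rw [ht, S.π_X]
    simp) (by rw [← hq₀, ← hfl]; rfl)
  set d := G.derivative.eval z with hd
  set z' := z + d * B ^ 2 * t ^ c * v with hz'
  have hk : ∀ j, ∃ k, ((a j).map evA.toRingHom).eval z' - ((a j).map evA.toRingHom).eval z =
      d * B ^ 2 * t ^ c * v * k := by
    intro j
    obtain ⟨k, hk⟩ := Polynomial.sub_dvd_eval_sub z' z ((a j).map evA.toRingHom)
    exact ⟨k, by rw [hk, hz']; ring⟩
  choose k hk using hk
  have hq' : ∀ j, B * y₁ (Sum.inr j) - ((a j).map evA.toRingHom).eval z =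
      (d * B) ^ 2 * t ^ (c + 1) * q j := by
    intro j
    rw [← hq j]
    change _ = MvPolynomial.aeval _ (_ - _)
    rw [map_sub, map_mul, hfl, hfl, MvPolynomial.aeval_X, Polynomial.map_C, Polynomial.eval_C]
    rfl
  let y : τ → S.A (n + 1) := fun j ↦
    y₁ (Sum.inr j) - t ^ c * (B * d ^ 2 * t * q j - d * B * v * k j)
  have hBy : ∀ j, B * y j = ((a j).map evA.toRingHom).eval z' := by
    intro j
    simp only [y]
    linear_combination hq' j - hk j
  have hy₁J : ∀ j, S.π (n + 1) (y₁ j) - w j ∈ J (n + 1) K ^ c := fun j ↦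
    Ideal.pow_le_pow_right c.le_succ (hy₁ j)
  have hPu : ∀ p, S.π (n + 1) (evA p) - ev p ∈ J (n + 1) K ^ c := by
    intro p
    rw [hevA, MvPolynomial.comp_aeval_apply, hev]
    refine aeval_sub_aeval_mem _ _ _ ?_ p
    rintro (i | i)
    · change S.π (n + 1) (S.X (n + 1) i) - _ ∈ _
      rw [S.π_X]
      exact (sub_self (MvPowerSeries.X i : MvPowerSeries (Fin (n + 1)) K)).symm ▸ Ideal.zero_mem _
    · exact hy₁J (Sum.inl (some i))
  have hPne : evA (b * ∏ i, s i) ≠ 0 := by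
    intro h0
    have h1 := hPu (b * ∏ i, s i)
    rw [h0, map_zero, zero_sub, neg_mem_iff] at h1
    exact hN₀ (Ideal.pow_le_pow_right (Nat.le_add_left _ _) h1)
  rw [map_mul, map_prod] at hPne
  have hBne : B ≠ 0 := left_ne_zero_of_mul hPne
  have hsne : ∀ i, evA (s i) ≠ 0 := fun i ↦
    Finset.prod_ne_zero_iff.mp (right_ne_zero_of_mul hPne) i (Finset.mem_univ i)
  refine ⟨y, fun i ↦ ?_, fun j ↦ ?_⟩
  · let ψ : Polynomial (MvPolynomial (Fin (n + 1) ⊕ σ) K) →ₐ[K] S.A (n + 1) :=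
      Polynomial.eval₂AlgHom evA z' (fun _ ↦ mul_comm _ _)
    have hψ : ∀ p, ψ p = (p.map evA.toRingHom).eval z' := fun p ↦ by
      rw [Polynomial.eval_map]
      rfl
    have hψC : ∀ p, ψ (Polynomial.C p) = evA p := fun p ↦ by
      rw [hψ, Polynomial.map_C, Polynomial.eval_C]
      rfl
    have h1 := hF i _ ψ y (fun j ↦ by rw [hψC, hψ]; exact hBy j)
    have h2 : ψ (F i) = 0 := by
      obtain ⟨r, hr⟩ := hs i
      have h3 := congrArg ψ hr
      rw [map_mul, map_mul, hψ g, hv, zero_mul, hψC] at h3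
      exact (mul_eq_zero.mp h3).resolve_left (hsne i)
    rw [h2, hψC] at h1
    have h4 := (mul_eq_zero.mp h1.symm).resolve_left (pow_ne_zero _ hBne)
    convert h4 using 4
    ext1 i
    rw [hψC, hevA, MvPolynomial.aeval_X]
    rfl
  · have h1 : S.π (n + 1) (t ^ c * (B * d ^ 2 * t * q j - d * B * v * k j)) ∈
        J (n + 1) K ^ c := by
      have h2 : (MvPowerSeries.X 0 : MvPowerSeries (Fin (n + 1)) K) ∈ J (n + 1) K :=
        Ideal.subset_span ⟨0, rfl⟩
      rw [map_mul, map_pow, ht, S.π_X]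
      exact Ideal.mul_mem_right _ _ (Ideal.pow_mem_pow h2 c)
    have h2 := sub_mem (hy₁J (Sum.inr j)) h1
    refine Ideal.pow_le_pow_right (Nat.le_add_right α N₀) ?_
    convert h2 using 1
    simp only [y, map_sub]
    change _ - yhat j = _ - yhat j - _
    ring

theorem approximable {K : Type} [Field K] (S : ApproxSystem K) (n : ℕ) : Approximable S n := by
  induction n with
  | zero => exact approximable_zero S
  | succ n ih => exact ih.succ

theorem exists_root_of_isAdicComplete {R : Type*} [CommRing R] (I : Ideal R) [IsAdicComplete I R]
    (p : Polynomial R) (h0 : p.coeff 0 ∈ I) (h1 : IsUnit (p.coeff 1)) : ∃ v, p.eval v = 0 := by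
  obtain ⟨u, hu⟩ := h1.exists_right_inv
  set T := p.divX.divX
  have hp : p = T * Polynomial.X ^ 2 + Polynomial.C (p.coeff 1) * Polynomial.X +
      Polynomial.C (p.coeff 0) := by
    conv_lhs => rw [← Polynomial.divX_mul_X_add p, ← Polynomial.divX_mul_X_add p.divX,
      Polynomial.coeff_divX, zero_add]
    ring
  have hev : ∀ v, p.eval v = T.eval v * v ^ 2 + p.coeff 1 * v + p.coeff 0 := fun v ↦ by
    conv_lhs => rw [hp]
    simp
  obtain ⟨c, hc0, hc⟩ : ∃ c : ℕ → R, c 0 = 0 ∧ ∀ n, c (n + 1) = c n - u * p.eval (c n) :=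
    ⟨fun n ↦ Nat.rec 0 (fun _ b ↦ b - u * p.eval b) n, rfl, fun n ↦ rfl⟩
  have hcI : ∀ n, c n ∈ I := by
    intro n
    induction n with
    | zero => exact hc0 ▸ I.zero_mem
    | succ n ih =>
      rw [hc, hev]
      refine I.sub_mem ih (I.mul_mem_left _ (I.add_mem (I.add_mem ?_ (I.mul_mem_left _ ih)) h0))
      exact I.mul_mem_left _ (I.pow_mem_of_mem ih 2 two_pos)
  have hdiff : ∀ n, c (n + 1) - c n ∈ I ^ n := by
    intro n
    induction n with
    | zero => simp
    | succ n ih =>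
      obtain ⟨k, hk⟩ := Polynomial.sub_dvd_eval_sub (c (n + 1)) (c n) T
      have h2 : c (n + 1 + 1) - c (n + 1) = (c (n + 1) - c n) *
          (-u * (k * c (n + 1) ^ 2 + T.eval (c n) * (c (n + 1) + c n))) := by
        rw [hc (n + 1)]
        have h3 := hc n
        rw [hev] at h3 ⊢
        linear_combination -u * c (n + 1) ^ 2 * hk - h3 - (c (n + 1) - c n) * hu
      rw [h2, pow_succ]
      refine Ideal.mul_mem_mul ih (I.mul_mem_left _ (I.add_mem
        (I.mul_mem_left _ (I.pow_mem_of_mem (hcI _) 2 two_pos))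
        (I.mul_mem_left _ (I.add_mem (hcI _) (hcI n)))))
  have hcauchy : ∀ {m n}, m ≤ n → c m ≡ c n [SMOD (I ^ m • ⊤ : Ideal R)] := by
    intro m n hmn
    rw [smul_eq_mul, Ideal.mul_top]
    induction n, hmn using Nat.le_induction with
    | base => rfl
    | succ n hmn ih =>
      refine ih.trans ?_
      rw [SModEq.comm, SModEq.sub_mem]
      exact Ideal.pow_le_pow_right hmn (hdiff n)
  obtain ⟨a, ha⟩ := IsPrecomplete.prec' c hcauchy
  refine ⟨a, IsHausdorff.haus' (I := I) _ fun n ↦ ?_⟩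
  have h2 := ha n
  rw [smul_eq_mul, Ideal.mul_top] at h2 ⊢
  refine (h2.symm.eval p).trans ?_
  rw [SModEq.zero]
  have h3 : p.eval (c n) = -(p.coeff 1 * (c (n + 1) - c n)) := by
    rw [hc]
    linear_combination -p.eval (c n) * hu
  rw [h3]
  exact neg_mem (Ideal.mul_mem_left _ _ (hdiff n))

section

variable {k : Type} [Field k] {n : ℕ}

/-- The algebraic power series. -/
noncomputable abbrev AlgSeries (k : Type) [Field k] (n : ℕ) :
    Subalgebra (MvPolynomial (Fin n) k) (MvPowerSeries (Fin n) k) :=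
  Subalgebra.algebraicClosure (MvPolynomial (Fin n) k) (MvPowerSeries (Fin n) k)

theorem AlgSeries.exists_root (p : Polynomial (AlgSeries k n))
    (h0 : MvPowerSeries.constantCoeff (p.coeff 0 : MvPowerSeries (Fin n) k) = 0)
    (h1 : MvPowerSeries.constantCoeff (p.coeff 1 : MvPowerSeries (Fin n) k) ≠ 0) :
    ∃ v, p.eval v = 0 := by
  obtain ⟨v, hv⟩ := exists_root_of_isAdicComplete
    (IsLocalRing.maximalIdeal (MvPowerSeries (Fin n) k)) (p.map (algebraMap (AlgSeries k n) _))
    (by rw [maximalIdeal_eq_J, mem_J_iff, Polynomial.coeff_map]; exact h0)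
    (by
      rw [Polynomial.coeff_map, MvPowerSeries.isUnit_iff_constantCoeff, isUnit_iff_ne_zero]
      exact h1)
  have hp : p ≠ 0 := by
    rintro rfl
    simp at h1
  have halg : IsAlgebraic (AlgSeries k n) v :=
    ⟨p, hp, by rwa [Polynomial.eval_map_algebraMap] at hv⟩
  refine ⟨⟨v, halg.restrictScalars (MvPolynomial (Fin n) k)⟩, Subtype.val_injective ?_⟩
  rw [Polynomial.eval_map_algebraMap] at hv
  rw [← Polynomial.coe_aeval_eq_eval]
  exact (Polynomial.aeval_algebraMap_apply (MvPowerSeries (Fin n) k)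
    (⟨v, halg.restrictScalars _⟩ : AlgSeries k n) p).symm.trans hv

/-- The substitution `xᵢ ↦ xᵢ₊₁ - x₀ ^ (γᵢ + 1)` on polynomials. -/
noncomputable def phiPoly (γ : Fin n → ℕ) :
    MvPolynomial (Fin n) k →ₐ[k] MvPolynomial (Fin (n + 1)) k :=
  MvPolynomial.aeval fun i ↦ MvPolynomial.X i.succ - MvPolynomial.X 0 ^ (γ i + 1)

theorem phiPoly_injective (γ : Fin n → ℕ) : Function.Injective (phiPoly (k := k) γ) := by
  let l : MvPolynomial (Fin (n + 1)) k →ₐ[k] MvPolynomial (Fin n) k :=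
    MvPolynomial.aeval (Fin.cons 0 MvPolynomial.X)
  have h : l.comp (phiPoly γ) = AlgHom.id k _ := by
    refine MvPolynomial.algHom_ext fun i ↦ ?_
    simp [phiPoly, l]
  intro x y hxy
  rw [← AlgHom.id_apply (R := k) x, ← AlgHom.id_apply (R := k) y, ← h, AlgHom.comp_apply, hxy,
    AlgHom.comp_apply]

theorem algebraMap_X (i : Fin n) : algebraMap (MvPolynomial (Fin n) k) (MvPowerSeries (Fin n) k)
    (MvPolynomial.X i) = MvPowerSeries.X i := by
  simp [MvPowerSeries.algebraMap_apply']

theorem isAlgebraic_phiHat (γ : Fin n → ℕ) {a : MvPowerSeries (Fin n) k}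
    (ha : IsAlgebraic (MvPolynomial (Fin n) k) a) :
    IsAlgebraic (MvPolynomial (Fin (n + 1)) k) (phiHat γ a) := by
  have h : (IsScalarTower.toAlgHom k (MvPolynomial (Fin (n + 1)) k)
      (MvPowerSeries (Fin (n + 1)) k)).comp (phiPoly γ) =
      (phiHat γ).comp (IsScalarTower.toAlgHom k (MvPolynomial (Fin n) k)
        (MvPowerSeries (Fin n) k)) := by
    refine MvPolynomial.algHom_ext fun i ↦ ?_
    rw [AlgHom.comp_apply, AlgHom.comp_apply, IsScalarTower.toAlgHom_apply,
      IsScalarTower.toAlgHom_apply, algebraMap_X, phiHat_X, phiPoly, MvPolynomial.aeval_X, map_sub,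
      map_pow, algebraMap_X, algebraMap_X]
  exact ha.ringHom_of_comp_eq (phiPoly γ).toRingHom (phiHat γ).toRingHom (phiPoly_injective γ)
    (congrArg (fun f ↦ f.toRingHom) h)

/-- The substitution `phiHat` on algebraic power series. -/
noncomputable def phiAlg (γ : Fin n → ℕ) : AlgSeries k n →+* AlgSeries k (n + 1) :=
  ((phiHat γ).toRingHom.comp (AlgSeries k n).val.toRingHom).codRestrict
    (AlgSeries k (n + 1)).toSubring fun a ↦ isAlgebraic_phiHat γ a.2

theorem coeff_phiHat_eq_sum (γ : Fin n → ℕ) (f : MvPowerSeries (Fin n) k) (e : Fin (n + 1) →₀ ℕ) :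
    MvPowerSeries.coeff e (phiHat γ f) =
      ∑ d ∈ (Finsupp.finite_of_degree_le (σ := Fin n) e.degree).toFinset,
        MvPowerSeries.coeff d f * MvPowerSeries.coeff e
          (phiHat γ (MvPowerSeries.monomial d (1 : k))) := by
  classical
  set s := (Finsupp.finite_of_degree_le (σ := Fin n) e.degree).toFinset with hs
  set g := ∑ d ∈ s, MvPowerSeries.C (MvPowerSeries.coeff d f) * MvPowerSeries.monomial d (1 : k)
  have h1 : f - g ∈ J n k ^ (e.degree + 1) := by
    rw [mem_J_pow_iff]
    intro d hd
    rw [map_sub, map_sum, Finset.sum_eq_single d]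
    · simp
    · intro b _ hb
      rw [MvPowerSeries.coeff_C_mul, MvPowerSeries.coeff_monomial_ne hb.symm, mul_zero]
    · intro h
      exact absurd (by rw [hs, Set.Finite.mem_toFinset]; exact Nat.lt_succ_iff.mp hd) h
  have h2 := (mem_J_pow_iff _ _).mp (phiHat_mem_J_pow γ _ h1) e (Nat.lt_succ_self _)
  rw [map_sub, map_sub, sub_eq_zero] at h2
  rw [h2, map_sum, map_sum]
  refine Finset.sum_congr rfl fun d _ ↦ ?_
  have h3 : phiHat γ (MvPowerSeries.C (MvPowerSeries.coeff d f)) =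
    MvPowerSeries.C (MvPowerSeries.coeff d f) := (phiHat γ).commutes _
  rw [map_mul, h3, MvPowerSeries.coeff_C_mul]

theorem coeff_phiHat_monomial_map {k' : Type} [Field k'] (ψ : k →+* k') (γ : Fin n → ℕ)
    (d : Fin n →₀ ℕ) (e : Fin (n + 1) →₀ ℕ) :
    MvPowerSeries.coeff e (phiHat γ (MvPowerSeries.monomial d (1 : k'))) =
      ψ (MvPowerSeries.coeff e (phiHat γ (MvPowerSeries.monomial d (1 : k)))) := by
  have h : ∀ (k' : Type) [Field k'], phiHat γ (MvPowerSeries.monomial d (1 : k')) =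
      ∏ i, (MvPowerSeries.X i.succ - MvPowerSeries.X 0 ^ (γ i + 1)) ^ d i := by
    intro k' _
    rw [MvPowerSeries.monomial_one_eq, Finsupp.prod_fintype _ _ (fun i ↦ pow_zero _), map_prod]
    simp only [map_pow, phiHat_X]
  have h' : MvPowerSeries.map ψ (phiHat γ (MvPowerSeries.monomial d (1 : k))) =
      phiHat γ (MvPowerSeries.monomial d (1 : k')) := by
    rw [h, h, map_prod]
    simp only [map_pow, map_sub, MvPowerSeries.map_X]
  rw [← h', MvPowerSeries.coeff_map]

end

section Ultrapower

open Filter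

/-- The ultrapower of `R` along a nonprincipal ultrafilter on `ℕ`. -/
abbrev Ultrapower (R : Type) : Type := Germ (hyperfilter ℕ : Filter ℕ) R

variable {R S : Type} [CommRing R] [CommRing S]

/-- The ring homomorphism induced on ultrapowers. -/
noncomputable def Ultrapower.map (f : R →+* S) : Ultrapower R →+* Ultrapower S where
  toFun := Germ.map f
  map_one' := by
    change (((fun _ ↦ f 1 : ℕ → S)) : Ultrapower S) = _
    rw [map_one]; rfl
  map_zero' := by
    change (((fun _ ↦ f 0 : ℕ → S)) : Ultrapower S) = _
    rw [map_zero]; rfl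
  map_mul' a b := by
    induction a using Germ.inductionOn with | _ a
    induction b using Germ.inductionOn with | _ b
    change (((fun i ↦ f (a i * b i) : ℕ → S)) : Ultrapower S) = _
    simp only [map_mul]; rfl
  map_add' a b := by
    induction a using Germ.inductionOn with | _ a
    induction b using Germ.inductionOn with | _ b
    change (((fun i ↦ f (a i + b i) : ℕ → S)) : Ultrapower S) = _
    simp only [map_add]; rfl

theorem Ultrapower.coe_sum {ι : Type*} (s : Finset ι) (a : ι → ℕ → R) :
    ((fun n ↦ ∑ i ∈ s, a i n : ℕ → R) : Ultrapower R) = ∑ i ∈ s, (a i : Ultrapower R) := by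
  have h : (fun n ↦ ∑ i ∈ s, a i n) = ∑ i ∈ s, a i := by
    ext n; simp
  rw [h]
  exact map_sum (Germ.coeRingHom (hyperfilter ℕ : Filter ℕ)) a s

instance Ultrapower.isDomain [IsDomain R] : IsDomain (Ultrapower R) := by
  have : NoZeroDivisors (Ultrapower R) := ⟨fun {a b} h ↦ by
    induction a using Germ.inductionOn with | _ a
    induction b using Germ.inductionOn with | _ b
    have h1 : ∀ᶠ i in (hyperfilter ℕ : Filter ℕ), a i = 0 ∨ b i = 0 := by
      have h2 : ∀ᶠ i in (hyperfilter ℕ : Filter ℕ), a i * b i = 0 := Germ.coe_eq.mp h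
      exact h2.mono fun i hi ↦ mul_eq_zero.mp hi
    rcases Ultrafilter.eventually_or.mp h1 with h1 | h1
    · exact Or.inl (Germ.coe_eq.mpr h1)
    · exact Or.inr (Germ.coe_eq.mpr h1)⟩
  exact NoZeroDivisors.to_isDomain _

/-- The power series over the ultrapower attached to an element of the ultrapower of the ring
of power series. -/
noncomputable def Ultrapower.seriesFun (k : Type) [Field k] (n : ℕ)
    (a : Ultrapower (MvPowerSeries (Fin n) k)) : MvPowerSeries (Fin n) (Ultrapower k) :=
  fun e ↦ Germ.map (MvPowerSeries.coeff e) a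

/-- `Ultrapower.seriesFun` as a ring homomorphism. -/
noncomputable def Ultrapower.series (k : Type) [Field k] (n : ℕ) :
    Ultrapower (MvPowerSeries (Fin n) k) →+* MvPowerSeries (Fin n) (Ultrapower k) where
  toFun := Ultrapower.seriesFun k n
  map_one' := by
    classical
    ext e
    change ((fun _ ↦ MvPowerSeries.coeff e 1 : ℕ → k) : Ultrapower k) = _
    rw [MvPowerSeries.coeff_one, MvPowerSeries.coeff_one]
    split_ifs <;> rfl
  map_zero' := by
    ext e
    change ((fun _ ↦ MvPowerSeries.coeff e 0 : ℕ → k) : Ultrapower k) = _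
    rw [map_zero, map_zero]
    rfl
  map_mul' a b := by
    classical
    induction a using Germ.inductionOn with | _ a
    induction b using Germ.inductionOn with | _ b
    ext e
    rw [MvPowerSeries.coeff_mul]
    change ((fun i ↦ MvPowerSeries.coeff e (a i * b i) : ℕ → k) : Ultrapower k) = _
    simp only [MvPowerSeries.coeff_mul]
    exact Ultrapower.coe_sum _ _
  map_add' a b := by
    induction a using Germ.inductionOn with | _ a
    induction b using Germ.inductionOn with | _ b
    ext e
    change ((fun i ↦ MvPowerSeries.coeff e (a i + b i) : ℕ → k) : Ultrapower k) = _
    simp only [map_add]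
    rfl

/-- A polynomial over an ultrapower comes from a sequence of polynomials. -/
theorem Ultrapower.exists_polynomial (p : Polynomial (Ultrapower R)) :
    ∃ P : ℕ → Polynomial R,
      (∀ j, ((fun i ↦ (P i).coeff j : ℕ → R) : Ultrapower R) = p.coeff j) ∧
      ∀ v : ℕ → R, p.eval (v : Ultrapower R) =
        ((fun i ↦ (P i).eval (v i) : ℕ → R) : Ultrapower R) := by
  have hr : ∀ a : Ultrapower R, ∃ r : ℕ → R, (r : Ultrapower R) = a := fun a ↦
    Germ.inductionOn a fun r ↦ ⟨r, rfl⟩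
  choose r hr using fun j ↦ hr (p.coeff j)
  refine ⟨fun i ↦ ∑ j ∈ Finset.range (p.natDegree + 1), Polynomial.monomial j (r j i), fun j ↦ ?_,
    fun v ↦ ?_⟩
  · by_cases hj : j < p.natDegree + 1
    · rw [← hr]
      congr 1
      ext i
      simp [Polynomial.coeff_monomial, Nat.lt_succ_iff.mp hj]
    · rw [Polynomial.coeff_eq_zero_of_natDegree_lt (by omega)]
      have h : ∀ i, (∑ j ∈ Finset.range (p.natDegree + 1),
          Polynomial.monomial j (r j i)).coeff j = 0 := by
        intro i
        simp [Polynomial.coeff_monomial]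
        omega
      simp only [h]
      rfl
  · rw [Polynomial.eval_eq_sum_range]
    simp only [Polynomial.eval_finsetSum, Polynomial.eval_monomial]
    rw [Ultrapower.coe_sum]
    refine Finset.sum_congr rfl fun j _ ↦ ?_
    rw [← hr]
    rfl

end Ultrapower

section System

open Filter

variable {k : Type} [Field k]

/-- Constant sequences. -/
noncomputable def Ultrapower.const (R : Type) [CommRing R] : R →+* Ultrapower R :=
  (Germ.coeRingHom (hyperfilter ℕ : Filter ℕ)).comp (Pi.constRingHom ℕ R)

theorem Ultrapower.const_apply {R : Type} [CommRing R] (r : R) :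
    Ultrapower.const R r = ((fun _ ↦ r : ℕ → R) : Ultrapower R) := rfl

noncomputable instance Ultrapower.algebraAlgSeries (n : ℕ) :
    Algebra (Ultrapower k) (Ultrapower (AlgSeries k n)) :=
  (Ultrapower.map (algebraMap k (AlgSeries k n))).toAlgebra

theorem Ultrapower.algebraMap_coe (n : ℕ) (a : ℕ → k) :
    algebraMap (Ultrapower k) (Ultrapower (AlgSeries k n)) (a : Ultrapower k) =
      ((fun i ↦ algebraMap k (AlgSeries k n) (a i) : ℕ → AlgSeries k n) : Ultrapower _) := rfl

/-- The comparison map from the ultrapower of the algebraic power series. -/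
noncomputable def Ultrapower.algSeriesToSeries (k : Type) [Field k] (n : ℕ) :
    Ultrapower (AlgSeries k n) →ₐ[Ultrapower k] MvPowerSeries (Fin n) (Ultrapower k) where
  toRingHom := (Ultrapower.series k n).comp (Ultrapower.map (AlgSeries k n).val.toRingHom)
  commutes' a := by
    classical
    induction a using Germ.inductionOn with | _ a
    have h : algebraMap (Ultrapower k) (MvPowerSeries (Fin n) (Ultrapower k)) (a : Ultrapower k) =
      MvPowerSeries.C (a : Ultrapower k) := rfl
    rw [h]
    ext e
    change ((fun i ↦ MvPowerSeries.coeff e (MvPowerSeries.C (a i)) : ℕ → k) : Ultrapower k) = _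
    simp only [MvPowerSeries.coeff_C]
    split_ifs <;> rfl

theorem Ultrapower.coeff_algSeriesToSeries_coe {n : ℕ} (a : ℕ → AlgSeries k n)
    (e : Fin n →₀ ℕ) :
    MvPowerSeries.coeff e (Ultrapower.algSeriesToSeries k n (a : Ultrapower _)) =
      ((fun i ↦ MvPowerSeries.coeff e (a i : MvPowerSeries (Fin n) k) : ℕ → k) :
        Ultrapower k) := rfl

/-- The variables as algebraic power series. -/
noncomputable def AlgSeries.X (i : Fin n) : AlgSeries k n :=
  algebraMap (MvPolynomial (Fin n) k) (AlgSeries k n) (MvPolynomial.X i)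

theorem AlgSeries.coe_X (i : Fin n) :
    ((AlgSeries.X i : AlgSeries k n) : MvPowerSeries (Fin n) k) = MvPowerSeries.X i :=
  algebraMap_X i

theorem phiAlg_X {n : ℕ} (γ : Fin n → ℕ) (i : Fin n) :
    phiAlg γ (AlgSeries.X i : AlgSeries k n) = AlgSeries.X i.succ - AlgSeries.X 0 ^ (γ i + 1) := by
  refine Subtype.val_injective ?_
  change phiHat γ ((AlgSeries.X i : AlgSeries k n) : MvPowerSeries (Fin n) k) =
    ((AlgSeries.X i.succ : AlgSeries k (n + 1)) : MvPowerSeries (Fin (n + 1)) k) -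
      ((AlgSeries.X 0 : AlgSeries k (n + 1)) : MvPowerSeries (Fin (n + 1)) k) ^ (γ i + 1)
  rw [AlgSeries.coe_X, AlgSeries.coe_X, AlgSeries.coe_X, phiHat_X]

theorem phiAlg_algebraMap {n : ℕ} (γ : Fin n → ℕ) (a : k) :
    phiAlg γ (algebraMap k (AlgSeries k n) a) = algebraMap k (AlgSeries k (n + 1)) a :=
  Subtype.val_injective ((phiHat γ).commutes a)

/-- The substitution on ultrapowers of algebraic power series. -/
noncomputable def Ultrapower.phi {n : ℕ} (γ : Fin n → ℕ) :
    Ultrapower (AlgSeries k n) →ₐ[Ultrapower k] Ultrapower (AlgSeries k (n + 1)) where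
  toRingHom := Ultrapower.map (phiAlg γ)
  commutes' a := by
    induction a using Germ.inductionOn with | _ a
    change ((fun i ↦ phiAlg γ (algebraMap k (AlgSeries k n) (a i)) : ℕ → AlgSeries k (n + 1)) :
      Ultrapower (AlgSeries k (n + 1))) = _
    simp only [phiAlg_algebraMap]
    rfl

theorem Ultrapower.algSeriesToSeries_phi {n : ℕ} (γ : Fin n → ℕ) (a : Ultrapower (AlgSeries k n)) :
    Ultrapower.algSeriesToSeries k (n + 1) (Ultrapower.phi γ a) =
      phiHat γ (Ultrapower.algSeriesToSeries k n a) := by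
  induction a using Germ.inductionOn with | _ a
  ext e
  rw [coeff_phiHat_eq_sum]
  change ((fun i ↦ MvPowerSeries.coeff e (phiHat γ (a i : MvPowerSeries (Fin n) k)) : ℕ → k) :
    Ultrapower k) = _
  simp only [fun i ↦ coeff_phiHat_eq_sum γ (a i : MvPowerSeries (Fin n) k) e]
  rw [Ultrapower.coe_sum]
  refine Finset.sum_congr rfl fun d _ ↦ ?_
  rw [coeff_phiHat_monomial_map (Ultrapower.const k)]
  rfl

theorem Ultrapower.exists_root {n : ℕ} (p : Polynomial (Ultrapower (AlgSeries k n)))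
    (h0 : MvPowerSeries.constantCoeff (Ultrapower.algSeriesToSeries k n (p.coeff 0)) = 0)
    (h1 : MvPowerSeries.constantCoeff (Ultrapower.algSeriesToSeries k n (p.coeff 1)) ≠ 0) :
    ∃ v, p.eval v = 0 := by
  classical
  obtain ⟨P, hP, hPv⟩ := Ultrapower.exists_polynomial p
  rw [← hP, ← MvPowerSeries.coeff_zero_eq_constantCoeff_apply,
    Ultrapower.coeff_algSeriesToSeries_coe] at h0 h1
  have h0' := Germ.coe_eq.mp h0
  have h1' := Ultrafilter.eventually_not.mpr fun h ↦ h1 (Germ.coe_eq.mpr h)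
  have hv : ∀ i, ∃ v, MvPowerSeries.constantCoeff ((P i).coeff 0 : MvPowerSeries (Fin n) k) = 0 →
      MvPowerSeries.constantCoeff ((P i).coeff 1 : MvPowerSeries (Fin n) k) ≠ 0 →
      (P i).eval v = 0 := by
    intro i
    by_cases h : MvPowerSeries.constantCoeff ((P i).coeff 0 : MvPowerSeries (Fin n) k) = 0 ∧
      MvPowerSeries.constantCoeff ((P i).coeff 1 : MvPowerSeries (Fin n) k) ≠ 0
    · obtain ⟨v, hv⟩ := AlgSeries.exists_root (P i) h.1 h.2
      exact ⟨v, fun _ _ ↦ hv⟩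
    · exact ⟨0, fun a b ↦ absurd ⟨a, b⟩ h⟩
  choose v hv using hv
  refine ⟨(v : Ultrapower _), ?_⟩
  rw [hPv]
  refine Germ.coe_eq.mpr ?_
  filter_upwards [h0', h1'] with i hi0 hi1
  exact hv i hi0 hi1

/-- The approximation system given by ultrapowers of rings of algebraic power series. -/
noncomputable def algSystem (k : Type) [Field k] : ApproxSystem (Ultrapower k) where
  A n := Ultrapower (AlgSeries k n)
  π := Ultrapower.algSeriesToSeries k
  X n i := Ultrapower.const _ (AlgSeries.X i)
  π_X n i := by
    classical
    ext e
    rw [Ultrapower.const_apply, Ultrapower.coeff_algSeriesToSeries_coe]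
    simp only [AlgSeries.coe_X, MvPowerSeries.coeff_X]
    split_ifs <;> rfl
  φ _ γ := Ultrapower.phi γ
  φ_X n γ i := by
    rw [← map_pow, ← map_sub, ← phiAlg_X]
    rfl
  π_φ _ γ a := Ultrapower.algSeriesToSeries_phi γ a
  hensel _ p h0 h1 := Ultrapower.exists_root p h0 h1

end System

section Final

open Filter

variable {k : Type} [Field k]

/-- Families of elements of a finite-dimensional space can be replaced by families of bounded
size with the same span. -/
theorem exists_span_range_eq {V : Type*} [AddCommGroup V] [Module k V] (W : Submodule k V)
    [Module.Finite k W] (s : Set V) (hs : s ⊆ W) :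
    ∃ g : Fin (Module.finrank k W) → V,
      Submodule.span k (Set.range g) = Submodule.span k s := by
  have hle : Submodule.span k s ≤ W := Submodule.span_le.mpr hs
  set U := Submodule.span k s
  have : Module.Finite k U := Submodule.finiteDimensional_of_le hle
  let b := Module.finBasis k U
  refine ⟨fun i ↦ if h : i.1 < Module.finrank k U then (b ⟨i, h⟩ : V) else 0, le_antisymm ?_ ?_⟩
  · rw [Submodule.span_le]
    rintro _ ⟨i, rfl⟩
    dsimp only
    split_ifs
    · exact (b _).2
    · exact U.zero_mem
  · intro u hu
    have h := congrArg Subtype.val (b.sum_repr ⟨u, hu⟩)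
    rw [← show _ = u from h, Submodule.coe_sum]
    refine Submodule.sum_mem _ fun i _ ↦ Submodule.smul_mem _ _ (Submodule.subset_span ?_)
    exact ⟨⟨i, i.2.trans_le (Submodule.finrank_mono hle)⟩, dif_pos i.2⟩

theorem aeval_eq_sum_degree_le {σ A : Type*} [Finite σ] [CommRing A] [Algebra k A] (v : σ → A)
    {g : MvPolynomial σ k} {d : ℕ} (hg : g.totalDegree ≤ d) :
    MvPolynomial.aeval v g = ∑ e ∈ (Finsupp.finite_of_degree_le (σ := σ) d).toFinset,
      algebraMap k A (g.coeff e) * e.prod fun i c ↦ v i ^ c := by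
  rw [MvPolynomial.aeval_def, MvPolynomial.eval₂_eq]
  refine Finset.sum_subset (fun e he ↦ ?_) fun e _ he ↦ ?_
  · rw [Set.Finite.mem_toFinset]
    exact (MvPolynomial.le_totalDegree he).trans hg
  · rw [MvPolynomial.notMem_support_iff.mp he, map_zero, zero_mul]

/-- The polynomial over the ultrapower attached to a sequence of polynomials of total degree at
most `d`. -/
noncomputable def ultraPolynomial {σ : Type} [Finite σ] (d : ℕ) (g : ℕ → MvPolynomial σ k) :
    MvPolynomial σ (Ultrapower k) :=
  ∑ e ∈ (Finsupp.finite_of_degree_le (σ := σ) d).toFinset,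
    MvPolynomial.monomial e ((fun b ↦ (g b).coeff e : ℕ → k) : Ultrapower k)

theorem aeval_ultraPolynomial {σ : Type} [Finite σ] {d n : ℕ} {g : ℕ → MvPolynomial σ k}
    (hg : ∀ b, (g b).totalDegree ≤ d) (v : σ → ℕ → AlgSeries k n) :
    MvPolynomial.aeval (fun t ↦ (v t : Ultrapower (AlgSeries k n))) (ultraPolynomial d g) =
      ((fun b ↦ MvPolynomial.aeval (fun t ↦ v t b) (g b) : ℕ → AlgSeries k n) :
        Ultrapower (AlgSeries k n)) := by
  simp only [fun b ↦ aeval_eq_sum_degree_le (fun t ↦ v t b) (hg b)]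
  rw [Ultrapower.coe_sum, ultraPolynomial, map_sum]
  refine Finset.sum_congr rfl fun e _ ↦ ?_
  rw [MvPolynomial.aeval_monomial, Ultrapower.algebraMap_coe]
  have h : (e.prod fun i c ↦ (v i : Ultrapower (AlgSeries k n)) ^ c) =
      ((fun b ↦ e.prod fun i c ↦ v i b ^ c : ℕ → AlgSeries k n) :
        Ultrapower (AlgSeries k n)) := by
    have h1 : (fun b ↦ e.prod fun i c ↦ v i b ^ c) = e.prod fun i c ↦ v i ^ c := by
      ext b
      simp [Finsupp.prod]
    rw [h1]
    exact (map_finsuppProd (Germ.coeRingHom (hyperfilter ℕ : Filter ℕ)) e fun i c ↦ v i ^ c).symm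
  rw [h]
  rfl

theorem AlgSeries.coe_aeval {n : ℕ} {τ : Type} (y : τ → AlgSeries k n)
    (p : MvPolynomial (Fin n ⊕ τ) k) :
    ((MvPolynomial.aeval (Sum.elim AlgSeries.X y) p : AlgSeries k n) : MvPowerSeries (Fin n) k) =
      MvPolynomial.aeval (Sum.elim MvPowerSeries.X fun j ↦ (y j : MvPowerSeries (Fin n) k)) p := by
  refine (MvPolynomial.comp_aeval_apply (Sum.elim AlgSeries.X y)
    ((AlgSeries k n).val.restrictScalars k) p).trans ?_
  congr 2
  funext t
  rcases t with i | j
  · exact AlgSeries.coe_X i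
  · rfl

theorem coe_aeval {n : ℕ} {τ : Type} (y : τ → MvPolynomial (Fin n) k)
    (p : MvPolynomial (Fin n ⊕ τ) k) :
    ((MvPolynomial.aeval (Sum.elim MvPolynomial.X y) p : MvPolynomial (Fin n) k) :
      MvPowerSeries (Fin n) k) =
      MvPolynomial.aeval (Sum.elim MvPowerSeries.X fun j ↦ (y j : MvPowerSeries (Fin n) k)) p := by
  have h : ∀ q : MvPolynomial (Fin n) k,
      IsScalarTower.toAlgHom k (MvPolynomial (Fin n) k) (MvPowerSeries (Fin n) k) q = q := by
    intro q
    simp [MvPowerSeries.algebraMap_apply']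
  rw [← h, MvPolynomial.comp_aeval_apply]
  congr 2
  funext t
  rcases t with i | j
  · exact (h _).trans (MvPolynomial.coe_X i)
  · exact h _

theorem aeval_mem_of_mem_span {σ A : Type*} [CommRing A] [Algebra k A] (I : Ideal A) (v : σ → A)
    {s : Set (MvPolynomial σ k)} (hs : ∀ f ∈ s, MvPolynomial.aeval v f ∈ I)
    {g : MvPolynomial σ k} (hg : g ∈ Submodule.span k s) : MvPolynomial.aeval v g ∈ I := by
  have h : Submodule.span k s ≤ (I.restrictScalars k).comap (MvPolynomial.aeval v).toLinearMap :=
    Submodule.span_le.mpr hs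
  exact h hg

/-- Some member of a sequence of increasingly accurate approximate solutions of systems of bounded
degree can be corrected to an exact algebraic solution. -/
theorem exists_exact_solution {n m d : ℕ} (α : ℕ) {r : ℕ → ℕ}
    {f : ∀ b, Fin (r b) → MvPolynomial (Fin n ⊕ Fin m) k} (hd : ∀ b i, (f b i).totalDegree ≤ d)
    {ybar : ℕ → Fin m → MvPolynomial (Fin n) k}
    (hy : ∀ b i, MvPolynomial.aeval (Sum.elim MvPolynomial.X (ybar b)) (f b i) ∈
      MvPolynomial.idealOfVars (Fin n) k ^ b) :
    ∃ b, ∃ y : Fin m → MvPowerSeries (Fin n) k,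
      (∀ j, IsAlgebraic (MvPolynomial (Fin n) k) (y j)) ∧
      (∀ i, MvPolynomial.aeval (Sum.elim MvPowerSeries.X y) (f b i) = 0) ∧
      ∀ j, (ybar b j : MvPowerSeries (Fin n) k) - y j ∈ J n k ^ α := by
  let W := MvPolynomial.restrictTotalDegree (Fin n ⊕ Fin m) k d
  choose g hg using fun b ↦ exists_span_range_eq W (Set.range (f b)) (by
    rintro _ ⟨i, rfl⟩
    exact (MvPolynomial.mem_restrictTotalDegree _ _ _).mpr (hd b i))
  have hgW : ∀ i b, (g b i).totalDegree ≤ d := by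
    intro i b
    rw [← MvPolynomial.mem_restrictTotalDegree]
    have h : Submodule.span k (Set.range (f b)) ≤ W := by
      rw [Submodule.span_le]
      rintro _ ⟨i, rfl⟩
      exact (MvPolynomial.mem_restrictTotalDegree _ _ _).mpr (hd b i)
    exact h (hg b ▸ Submodule.subset_span ⟨i, rfl⟩)
  let ybarAlg : Fin m → ℕ → AlgSeries k n := fun j b ↦
    algebraMap (MvPolynomial (Fin n) k) (AlgSeries k n) (ybar b j)
  have hybarAlg : ∀ j b, (ybarAlg j b : MvPowerSeries (Fin n) k) = ybar b j := by
    intro j b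
    change algebraMap (MvPolynomial (Fin n) k) (MvPowerSeries (Fin n) k) (ybar b j) = _
    simp [MvPowerSeries.algebraMap_apply']
  let F i := ultraPolynomial d fun b ↦ g b i
  have key : ∀ (z : Fin m → ℕ → AlgSeries k n) (i), MvPolynomial.aeval
      (Sum.elim ((algSystem k).X n) fun j ↦ (z j : Ultrapower (AlgSeries k n))) (F i) =
      ((fun b ↦ MvPolynomial.aeval (Sum.elim AlgSeries.X fun j ↦ z j b) (g b i) :
        ℕ → AlgSeries k n) : Ultrapower (AlgSeries k n)) := by
    intro z i
    have h := aeval_ultraPolynomial (hgW i) (Sum.elim (fun t _ ↦ AlgSeries.X t) z)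
    have h1 : ∀ b, (fun t ↦ Sum.elim (fun t _ ↦ AlgSeries.X t) z t b) =
        Sum.elim (AlgSeries.X (k := k)) fun j ↦ z j b := by
      intro b
      funext t
      rcases t with _ | _ <;> rfl
    have h2 : (fun t ↦ ((Sum.elim (fun t _ ↦ AlgSeries.X t) z t : ℕ → AlgSeries k n) :
        Ultrapower (AlgSeries k n))) = Sum.elim ((algSystem k).X n)
          fun j ↦ (z j : Ultrapower (AlgSeries k n)) := by
      funext t
      rcases t with _ | _ <;> rfl
    simp only [h1] at h
    rw [← h, ← h2]
    rfl
  have hsol : ∀ i, MvPolynomial.aeval (Sum.elim MvPowerSeries.X fun j ↦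
      (algSystem k).π n (ybarAlg j : Ultrapower (AlgSeries k n))) (F i) = 0 := by
    intro i
    have h := MvPolynomial.comp_aeval_apply (Sum.elim ((algSystem k).X n)
      fun j ↦ (ybarAlg j : Ultrapower (AlgSeries k n))) ((algSystem k).π n) (F i)
    have h1 : (fun t ↦ (algSystem k).π n (Sum.elim ((algSystem k).X n)
      (fun j ↦ (ybarAlg j : Ultrapower (AlgSeries k n))) t)) = Sum.elim MvPowerSeries.X fun j ↦
      (algSystem k).π n (ybarAlg j : Ultrapower (AlgSeries k n)) := by
      funext t
      rcases t with t | _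
      · exact (algSystem k).π_X n t
      · rfl
    rw [← h1, ← h, key]
    ext e
    refine (Ultrapower.coeff_algSeriesToSeries_coe _ e).trans (Germ.coe_eq.mpr ?_)
    have h2 : ∀ᶠ b in (hyperfilter ℕ : Filter ℕ), e.degree < b :=
      Nat.hyperfilter_le_atTop (eventually_gt_atTop _)
    filter_upwards [h2] with b hb
    rw [AlgSeries.coe_aeval]
    simp only [hybarAlg]
    rw [← coe_aeval, MvPolynomial.coeff_coe]
    have h3 : MvPolynomial.aeval (Sum.elim MvPolynomial.X (ybar b)) (g b i) ∈
        MvPolynomial.idealOfVars (Fin n) k ^ b :=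
      aeval_mem_of_mem_span _ _ (s := Set.range (f b)) (by
        rintro _ ⟨i, rfl⟩
        exact hy b i) (hg b ▸ Submodule.subset_span ⟨i, rfl⟩)
    exact (MvPolynomial.mem_pow_idealOfVars_iff' _ _).mp h3 e hb
  obtain ⟨y, hy0, hyc⟩ := approximable (algSystem k) n (Fin m) _ F _ hsol α
  have hrep : ∀ a : Ultrapower (AlgSeries k n), ∃ z : ℕ → AlgSeries k n,
      (z : Ultrapower (AlgSeries k n)) = a := fun a ↦ Germ.inductionOn a fun z ↦ ⟨z, rfl⟩
  choose z hz using fun j ↦ hrep (y j)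
  have hzy : (fun j ↦ (z j : Ultrapower (AlgSeries k n))) = y := funext hz
  have hev1 : ∀ᶠ b in (hyperfilter ℕ : Filter ℕ), ∀ i,
      MvPolynomial.aeval (Sum.elim AlgSeries.X fun j ↦ z j b) (g b i) = 0 := by
    rw [eventually_all]
    intro i
    have h := hy0 i
    rw [← hzy, key] at h
    exact Germ.coe_eq.mp h
  have hev2 : ∀ᶠ b in (hyperfilter ℕ : Filter ℕ), ∀ j,
      ∀ e ∈ {e : Fin n →₀ ℕ | e.degree ≤ α},
        MvPowerSeries.coeff e (z j b : MvPowerSeries (Fin n) k) =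
          MvPowerSeries.coeff e (ybarAlg j b : MvPowerSeries (Fin n) k) ∨ ¬ e.degree < α := by
    rw [eventually_all]
    intro j
    rw [(Finsupp.finite_of_degree_le (σ := Fin n) α).eventually_all]
    intro e _
    by_cases he : e.degree < α
    · have h := (mem_J_pow_iff _ _).mp (hyc j) e he
      rw [map_sub, sub_eq_zero, ← hz] at h
      exact (Germ.coe_eq.mp h).mono fun b hb ↦ Or.inl hb
    · exact Eventually.of_forall fun _ ↦ Or.inr he
  obtain ⟨b, hb1, hb2⟩ := (hev1.and hev2).exists
  refine ⟨b, fun j ↦ (z j b : MvPowerSeries (Fin n) k), fun j ↦ (z j b).2, fun i ↦ ?_, fun j ↦ ?_⟩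
  · rw [← AlgSeries.coe_aeval]
    have h : f b i ∈ Submodule.span k (Set.range (g b)) := hg b ▸ Submodule.subset_span ⟨i, rfl⟩
    have h1 := aeval_mem_of_mem_span (⊥ : Ideal (AlgSeries k n)) _ (by
      rintro _ ⟨i, rfl⟩
      exact hb1 i) h
    rw [(Ideal.mem_bot).mp h1]
    rfl
  refine (mem_J_pow_iff _ _).mpr fun e he ↦ ?_
  rw [map_sub, sub_eq_zero]
  rcases hb2 j e he.le with h | h
  · rw [h, hybarAlg]
  · exact absurd he h

end Final

end ArtinApprox

/-- **Universal strong Artin approximation** (Artin, Théorème 6.1). For every tuple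
`(n, m, d, α)` there is a bound `β` such that: for any family of polynomials
`f₁,…,f_r ∈ k[x₁,…,x_n,y₁,…,y_m]` of total degree at most `d`, any approximate
polynomial solution `ȳ` with `f i (x, ȳ(x)) ≡ 0 mod (x)^β` can be corrected to an exact
power series solution `y` with each `y j` algebraic over `k[x₁,…,x_n]` and
`y j ≡ ȳ j mod (x)^α`. -/
theorem stmt_8 (k : Type) [Field k] (n m d α : ℕ) :
    ∃ β : ℕ, ∀ (r : ℕ) (f : Fin r → MvPolynomial (Fin n ⊕ Fin m) k),
      (∀ i, (f i).totalDegree ≤ d) →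
      ∀ ybar : Fin m → MvPolynomial (Fin n) k,
        (∀ i, MvPolynomial.aeval (Sum.elim MvPolynomial.X ybar) (f i) ∈
          (Ideal.span (Set.range (MvPolynomial.X : Fin n → MvPolynomial (Fin n) k))) ^ β) →
        ∃ y : Fin m → MvPowerSeries (Fin n) k,
          (∀ j, IsAlgebraic (MvPolynomial (Fin n) k) (y j)) ∧
          (∀ i, MvPolynomial.aeval (Sum.elim MvPowerSeries.X y) (f i) = 0) ∧
          (∀ j, ((ybar j : MvPowerSeries (Fin n) k) - y j) ∈
            (Ideal.span (Set.range (MvPowerSeries.X : Fin n → MvPowerSeries (Fin n) k))) ^ α) := by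
  by_contra! h
  choose r f hd ybar hy hbad using h
  obtain ⟨b, y, halg, hzero, hclose⟩ := ArtinApprox.exists_exact_solution α hd hy
  obtain ⟨j, hj⟩ := hbad b y halg hzero
  exact hj (hclose j)
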